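/- arXiv:2502.15659 — 5 statements merged into one kernel-verified Lean document; each statement's English description precedes it below -/
import Mathlib

section
/- Let ρ be a d×d density matrix and σ a d×d positive semidefinite complex matrix. Then the infimum over all positive definite d×d matrices ω of tr[ρ ω⁻¹] · tr[σ ω] is at most tr[Π_ρ σ]. Equivalently, the measured Rényi-1/2 divergence D_{M,1/2}(ρ‖σ) := −log inf_{ω ≻ 0} tr[ρ ω⁻¹] tr[σ ω] satisfies D_min(ρ‖σ) := −log tr[Π_ρ σ] ≤ D_{M,1/2}(ρ‖σ). -/
open scoped Kronecker ComplexOrder Matrix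

attribute [local instance] Classical.propDecidable

noncomputable section

namespace QIT

variable {n : Type*} [Fintype n] [DecidableEq n]

/-- Base-2 matrix logarithm taken on the support (junk value `0` for non-Hermitian input). -/
def matLog (A : Matrix n n ℂ) : Matrix n n ℂ :=
  if hA : A.IsHermitian then
    (hA.eigenvectorUnitary : Matrix n n ℂ) *
      Matrix.diagonal (fun i => if hA.eigenvalues i = 0 then (0 : ℂ)
        else (Real.logb 2 (hA.eigenvalues i) : ℂ)) *
      (hA.eigenvectorUnitary : Matrix n n ℂ)ᴴ
  else 0

/-- Orthogonal projection onto the support of a Hermitian matrix. -/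
def suppProj (A : Matrix n n ℂ) : Matrix n n ℂ :=
  if hA : A.IsHermitian then
    (hA.eigenvectorUnitary : Matrix n n ℂ) *
      Matrix.diagonal (fun i => if hA.eigenvalues i = 0 then (0 : ℂ) else 1) *
      (hA.eigenvectorUnitary : Matrix n n ℂ)ᴴ
  else 0

/-- Support inclusion `supp ρ ⊆ supp σ`, phrased via kernels. -/
def suppLE (ρ σ : Matrix n n ℂ) : Prop :=
  ∀ x : n → ℂ, σ.mulVec x = 0 → ρ.mulVec x = 0

/-- Umegaki relative entropy (base 2), `+∞` when supports are not included. -/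
def relEnt (ρ σ : Matrix n n ℂ) : EReal :=
  if suppLE ρ σ then (((ρ * (matLog ρ - matLog σ)).trace).re : EReal) else ⊤

/-- Classical relative-entropy summand `p log₂(p/q)` with conventions
`0 · log(0/q) = 0` and `p · log(p/0) = +∞` for `p ≠ 0`. -/
def klTerm (p q : ℝ) : EReal :=
  if p = 0 then 0 else if q = 0 then ⊤ else ((p * Real.logb 2 (p / q) : ℝ) : EReal)

/-- A finite POVM. -/
def IsPOVM {m : ℕ} (M : Fin m → Matrix n n ℂ) : Prop :=
  (∀ x, (M x).PosSemidef) ∧ ∑ x, M x = 1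

/-- Measured relative entropy (base 2). -/
def measRelEnt (ρ σ : Matrix n n ℂ) : EReal :=
  ⨆ (m : ℕ) (M : Fin m → Matrix n n ℂ) (_ : IsPOVM M),
    ∑ x, klTerm ((M x * ρ).trace).re ((M x * σ).trace).re

/-- Trace norm: sum of singular values. -/
def traceNorm (A : Matrix n n ℂ) : ℝ :=
  ∑ i, Real.sqrt ((Matrix.posSemidef_conjTranspose_mul_self A).1.eigenvalues i)

/-- Operator (spectral) norm: largest singular value. -/
def opNorm (A : Matrix n n ℂ) : ℝ :=
  ⨆ i, Real.sqrt ((Matrix.posSemidef_conjTranspose_mul_self A).1.eigenvalues i)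

/-- Partial transpose on the second tensor factor. -/
def ptB {α β : Type*} (X : Matrix (α × β) (α × β) ℂ) : Matrix (α × β) (α × β) ℂ :=
  Matrix.of fun p q => X (p.1, q.2) (q.1, p.2)

/-- Kronecker product of two bipartite matrices, reindexed to the bipartition (A×A') : (B×B'). -/
def kron2 {α β γ δ : Type*} (X : Matrix (α × β) (α × β) ℂ) (Y : Matrix (γ × δ) (γ × δ) ℂ) :
    Matrix ((α × γ) × β × δ) ((α × γ) × β × δ) ℂ :=
  Matrix.reindex (Equiv.prodProdProdComm α β γ δ) (Equiv.prodProdProdComm α β γ δ) (X ⊗ₖ Y)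

/-- The permutation unitary on `(ℂ^d)^{⊗ m}`. -/
def permMat (d m : ℕ) (π : Equiv.Perm (Fin m)) :
    Matrix (Fin m → Fin d) (Fin m → Fin d) ℂ :=
  Matrix.of fun f g => if f ∘ π = g then 1 else 0

/-- Membership in the `PPT_k` set. -/
def memPPTk {α β : Type*} [Fintype α] [Fintype β] [DecidableEq α] [DecidableEq β]
    (k : ℕ) (X : Matrix (α × β) (α × β) ℂ) : Prop :=
  X.PosSemidef ∧ ∃ ω : ℕ → Matrix (α × β) (α × β) ℂ,
    ω 1 = X ∧ (∀ i ∈ Finset.Icc 1 k, (ω i).IsHermitian) ∧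
    (∀ i ∈ Finset.Icc 1 (k - 1),
      ((ω (i + 1)) - ptB (ω i)).PosSemidef ∧ ((ω (i + 1)) + ptB (ω i)).PosSemidef) ∧
    traceNorm (ptB (ω k)) ≤ 1

/-- Membership in the Rains set. -/
def memRains {α β : Type*} [Fintype α] [Fintype β] [DecidableEq α] [DecidableEq β]
    (σ : Matrix (α × β) (α × β) ℂ) : Prop :=
  σ.PosSemidef ∧ traceNorm (ptB σ) ≤ 1


open scoped MatrixOrder Matrix.Norms.L2Operator in
theorem re_trace_mul_nonneg {A B : Matrix n n ℂ} (hA : A.PosSemidef) (hB : B.PosSemidef) :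
    0 ≤ ((A * B).trace).re := by
  obtain ⟨C, rfl⟩ := CStarAlgebra.nonneg_iff_eq_star_mul_self.mp hA.nonneg
  rw [Matrix.mul_assoc, Matrix.trace_mul_comm]
  exact (Complex.nonneg_iff.mp (hB.mul_mul_conjTranspose_same C).trace_nonneg).1

theorem mul_suppProj {A : Matrix n n ℂ} (hA : A.IsHermitian) : A * suppProj A = A := by
  have hU : (hA.eigenvectorUnitary : Matrix n n ℂ)ᴴ * hA.eigenvectorUnitary = 1 :=
    Unitary.coe_star_mul_self hA.eigenvectorUnitary
  have hspec : A = (hA.eigenvectorUnitary : Matrix n n ℂ) *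
      Matrix.diagonal (fun i => (hA.eigenvalues i : ℂ)) *
      (hA.eigenvectorUnitary : Matrix n n ℂ)ᴴ := hA.spectral_theorem
  rw [suppProj, dif_pos hA]
  generalize (hA.eigenvectorUnitary : Matrix n n ℂ) = U at hU hspec ⊢
  generalize hA.eigenvalues = l at hspec ⊢
  subst hspec
  rw [show ∀ D E : Matrix n n ℂ, U * D * Uᴴ * (U * E * Uᴴ) = U * (D * (Uᴴ * U) * E) * Uᴴ by
    intros; noncomm_ring, hU, mul_one, Matrix.diagonal_mul_diagonal]
  congr 3
  ext i
  split_ifs with h <;> simp [h]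

theorem suppProj_mul_self (A : Matrix n n ℂ) : suppProj A * suppProj A = suppProj A := by
  by_cases hA : A.IsHermitian
  · have hU : (hA.eigenvectorUnitary : Matrix n n ℂ)ᴴ * hA.eigenvectorUnitary = 1 :=
      Unitary.coe_star_mul_self hA.eigenvectorUnitary
    rw [suppProj, dif_pos hA]
    generalize (hA.eigenvectorUnitary : Matrix n n ℂ) = U at hU ⊢
    rw [show ∀ D E : Matrix n n ℂ, U * D * Uᴴ * (U * E * Uᴴ) = U * (D * (Uᴴ * U) * E) * Uᴴ by
      intros; noncomm_ring, hU, mul_one, Matrix.diagonal_mul_diagonal]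
    congr 3
    ext i
    split_ifs <;> simp
  · simp [suppProj, hA]

theorem isHermitian_suppProj (A : Matrix n n ℂ) : (suppProj A).IsHermitian := by
  by_cases hA : A.IsHermitian
  · rw [suppProj, dif_pos hA]
    refine Matrix.isHermitian_mul_mul_conjTranspose _ ?_
    refine Matrix.isHermitian_diagonal_of_self_adjoint _ ?_
    ext i
    by_cases h : hA.eigenvalues i = 0 <;> simp [h]
  · simp [suppProj, hA]

/-- The regularization `P + ε (1 - P)` of an orthogonal projection `P` has inverse
`P + ε⁻¹ (1 - P)`. -/
theorem add_smul_one_sub_mul {P : Matrix n n ℂ} (hP : P * P = P) {ε : ℝ} (hε : 0 < ε) :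
    (P + ε • (1 - P)) * (P + ε⁻¹ • (1 - P)) = 1 := by
  have h₁ : P * (1 - P) = 0 := by rw [mul_sub, mul_one, hP, sub_self]
  have h₂ : (1 - P) * P = 0 := by rw [sub_mul, one_mul, hP, sub_self]
  have h₃ : (1 - P) * (1 - P) = 1 - P := by rw [mul_sub, mul_one, h₂, sub_zero]
  rw [add_mul, mul_add, mul_add, hP, mul_smul_comm, h₁, smul_mul_assoc, h₂, smul_mul_smul_comm,
    h₃, mul_inv_cancel₀ hε.ne']
  simp

theorem posDef_add_smul_one_sub {P : Matrix n n ℂ} (hP : P * P = P) (hPH : P.IsHermitian)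
    {ε : ℝ} (hε : 0 < ε) : (P + ε • (1 - P)).PosDef := by
  have hpsd : ∀ Q : Matrix n n ℂ, Q * Q = Q → Q.IsHermitian → Q.PosSemidef := by
    intro Q hQ hQH
    have h := Matrix.posSemidef_conjTranspose_mul_self Q
    rwa [hQH.eq, hQ] at h
  have h₁ := hpsd P hP hPH
  have h₂ := hpsd (1 - P) (by simp [mul_sub, sub_mul, hP]) (Matrix.isHermitian_one.sub hPH)
  have h₃ : (P + ε • (1 - P)).PosSemidef := h₁.add (h₂.smul hε.le)
  exact h₃.posDef_iff_isUnit.mpr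
    ((Matrix.isUnit_iff_isUnit_det _).mpr
      (Matrix.isUnit_det_of_right_inverse (add_smul_one_sub_mul hP hε)))

/-- `D_min(ρ‖σ) ≤ D_{M,1/2}(ρ‖σ)`, in the form
`inf_{ω ≻ 0} tr[ρ ω⁻¹] · tr[σ ω] ≤ tr[Π_ρ σ]`. -/
theorem measured_renyi_half_ge_min {d : ℕ} (ρ σ : Matrix (Fin d) (Fin d) ℂ)
    (hρ : ρ.PosSemidef) (hρ1 : ρ.trace = 1) (hσ : σ.PosSemidef) :
    sInf {r : ℝ | ∃ ω : Matrix (Fin d) (Fin d) ℂ, ω.PosDef ∧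
        r = ((ρ * ω⁻¹).trace).re * ((σ * ω).trace).re} ≤
      ((suppProj ρ * σ).trace).re := by
  have hbdd : BddBelow {r : ℝ | ∃ ω : Matrix (Fin d) (Fin d) ℂ, ω.PosDef ∧
      r = ((ρ * ω⁻¹).trace).re * ((σ * ω).trace).re} := by
    refine ⟨0, ?_⟩
    rintro r ⟨ω, hω, rfl⟩
    exact mul_nonneg (re_trace_mul_nonneg hρ hω.inv.posSemidef)
      (re_trace_mul_nonneg hσ hω.posSemidef)
  have hle : ∀ ε : ℝ, 0 < ε → sInf {r : ℝ | ∃ ω : Matrix (Fin d) (Fin d) ℂ, ω.PosDef ∧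
      r = ((ρ * ω⁻¹).trace).re * ((σ * ω).trace).re} ≤
      ((suppProj ρ * σ).trace).re + ε * ((σ * (1 - suppProj ρ)).trace).re := by
    intro ε hε
    have hP := suppProj_mul_self ρ
    refine csInf_le hbdd
      ⟨_, posDef_add_smul_one_sub hP (isHermitian_suppProj ρ) hε, ?_⟩
    have hρω : ρ * (suppProj ρ + ε⁻¹ • (1 - suppProj ρ)) = ρ := by
      rw [mul_add, mul_smul_comm, mul_sub, mul_one, mul_suppProj hρ.isHermitian, sub_self,
        smul_zero, add_zero]
    rw [Matrix.inv_eq_right_inv (add_smul_one_sub_mul hP hε), hρω, hρ1, mul_add,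
      Matrix.trace_add, mul_smul_comm, Matrix.trace_smul, Matrix.trace_mul_comm σ (suppProj ρ)]
    simp
  have hlim : Filter.Tendsto (fun ε : ℝ => ((suppProj ρ * σ).trace).re +
      ε * ((σ * (1 - suppProj ρ)).trace).re) (nhdsWithin 0 (Set.Ioi 0))
      (nhds ((suppProj ρ * σ).trace).re) := by
    refine Filter.Tendsto.mono_left ?_ nhdsWithin_le_nhds
    exact Continuous.tendsto' (by fun_prop) _ _ (by simp)
  exact ge_of_tendsto hlim (Filter.eventually_of_mem self_mem_nhdsWithin hle)

end QIT
end
end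

section
/- Let ρ be a density matrix and σ a positive semidefinite matrix of the same size, with the support of ρ contained in the support of σ. Then for every finite POVM {M_x}_{x∈X} (a finite family of positive semidefinite matrices with Σ_x M_x = I), the classical Kullback–Leibler divergence of the outcome distributions satisfies Σ_x tr[M_x ρ] · log( tr[M_x ρ] / tr[M_x σ] ) ≤ D(ρ‖σ). Consequently the measured relative entropy satisfies D_M(ρ‖σ) ≤ D(ρ‖σ). -/
open scoped Kronecker ComplexOrder Matrix

attribute [local instance] Classical.propDecidable

noncomputable section

namespace QIT

variable {n : Type*} [Fintype n] [DecidableEq n]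

theorem ereal_coe_sum {κ : Type*} (S : Finset κ) (f : κ → ℝ) :
    ((∑ x ∈ S, f x : ℝ) : EReal) = ∑ x ∈ S, (f x : EReal) :=
  map_sum (⟨⟨Real.toEReal, EReal.coe_zero⟩, EReal.coe_add⟩ : ℝ →+ EReal) f S

open Filter Topology in
/-- If `P ≪ Q` and `p ≪ q` are finite families of nonnegative numbers with `P` and `p` of the same
total mass, then a comparison of the sums `∑ p² / (q + t p)` for all `t > 0` implies the comparison
of the relative entropies. -/
theorem sum_mul_log_div_le_of_sum_sq_div_le {ι κ : Type*} [Fintype ι] [Fintype κ]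
    {p q : ι → ℝ} {P Q : κ → ℝ} (hp : ∀ i, 0 ≤ p i) (hq : ∀ i, 0 ≤ q i)
    (hP : ∀ i, 0 ≤ P i) (hQ : ∀ i, 0 ≤ Q i) (hpq : ∀ i, q i = 0 → p i = 0)
    (hPQ : ∀ i, Q i = 0 → P i = 0) (hsum : ∑ i, p i = ∑ i, P i)
    (h : ∀ t : ℝ, 0 < t →
      ∑ i, p i ^ 2 / (q i + t * p i) ≤ ∑ i, P i ^ 2 / (Q i + t * P i)) :
    ∑ i, p i * Real.log (p i / q i) ≤ ∑ i, P i * Real.log (P i / Q i) := by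
  have deriv_term : ∀ {a b : ℝ}, 0 ≤ a → 0 ≤ b → (b = 0 → a = 0) → ∀ t : ℝ, 0 ≤ t →
      HasDerivAt (fun t => a * Real.log ((b + t * a) / b)) (a ^ 2 / (b + t * a)) t := by
    intro a b ha hb hab t ht
    by_cases h0 : b = 0
    · simpa [hab h0] using hasDerivAt_const t (0 : ℝ)
    have hb' : 0 < b := lt_of_le_of_ne hb (Ne.symm h0)
    have hpos : 0 < b + t * a := by positivity
    have h1 : HasDerivAt (fun t => (b + t * a) / b) (a / b) t := by
      simpa using (((hasDerivAt_id t).mul_const a).const_add b).div_const b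
    refine ((h1.log (by positivity)).const_mul a).congr_deriv ?_
    field_simp
  have lim_term : ∀ {a b : ℝ}, 0 ≤ a → 0 ≤ b → (b = 0 → a = 0) →
      Tendsto (fun ε => a * Real.log ((ε * b + a) / b)) (𝓝[>] 0)
        (𝓝 (a * Real.log (a / b))) := by
    intro a b ha hb hab
    by_cases h0 : a = 0
    · simp [h0]
    have hb0 : b ≠ 0 := fun h => h0 (hab h)
    have hc : ContinuousAt (fun ε : ℝ => a * Real.log ((ε * b + a) / b)) 0 := by
      refine continuousAt_const.mul (ContinuousAt.log (by fun_prop) ?_)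
      simp [h0, hb0]
    have := hc.tendsto.mono_left (nhdsWithin_le_nhds (s := Set.Ioi 0))
    simpa using this
  have scale_term : ∀ {a b : ℝ}, 0 ≤ a → 0 ≤ b → (b = 0 → a = 0) → ∀ ε : ℝ, 0 < ε →
      a * Real.log ((ε * b + a) / b) =
        a * Real.log ((b + ε⁻¹ * a) / b) + a * Real.log ε := by
    intro a b ha hb hab ε hε
    by_cases h0 : a = 0
    · simp [h0]
    have hb' : 0 < b := lt_of_le_of_ne hb (fun h => h0 (hab h.symm))
    rw [← mul_add, ← Real.log_mul (by positivity) hε.ne']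
    congr 2
    field_simp
  have zero_term : ∀ {a b : ℝ}, (b = 0 → a = 0) →
      a * Real.log ((b + 0 * a) / b) = 0 := by
    intro a b hab
    by_cases h0 : b = 0
    · simp [h0]
    · simp [h0]
  have key : ∀ t : ℝ, 0 ≤ t → ∑ i, p i * Real.log ((q i + t * p i) / q i) ≤
      ∑ i, P i * Real.log ((Q i + t * P i) / Q i) := by
    intro t ht
    have hd : ∀ t : ℝ, 0 ≤ t → HasDerivAt
        (fun t => ∑ i, P i * Real.log ((Q i + t * P i) / Q i) -
          ∑ i, p i * Real.log ((q i + t * p i) / q i))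
        (∑ i, P i ^ 2 / (Q i + t * P i) - ∑ i, p i ^ 2 / (q i + t * p i)) t := fun t ht =>
      (HasDerivAt.fun_sum fun i _ => deriv_term (hP i) (hQ i) (hPQ i) t ht).sub
        (HasDerivAt.fun_sum fun i _ => deriv_term (hp i) (hq i) (hpq i) t ht)
    have hm := monotoneOn_of_deriv_nonneg (convex_Ici (0 : ℝ))
      (fun t ht => (hd t ht).continuousAt.continuousWithinAt)
      (fun t ht => (hd t (interior_subset ht)).differentiableAt.differentiableWithinAt)
      (fun t ht => by
        rw [(hd t (interior_subset ht)).deriv, sub_nonneg]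
        exact h t (by simpa using ht))
    have h0 := hm (Set.self_mem_Ici) (show t ∈ Set.Ici (0 : ℝ) from ht) ht
    simp only [zero_term (hPQ _), zero_term (hpq _)] at h0
    simpa using h0
  refine le_of_tendsto_of_tendsto
    (tendsto_finsetSum _ fun i _ => lim_term (hp i) (hq i) (hpq i))
    (tendsto_finsetSum _ fun i _ => lim_term (hP i) (hQ i) (hPQ i)) ?_
  filter_upwards [self_mem_nhdsWithin] with ε hε
  have hε' : 0 < ε := hε
  simp only [scale_term (hp _) (hq _) (hpq _) ε hε', scale_term (hP _) (hQ _) (hPQ _) ε hε',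
    Finset.sum_add_distrib, ← Finset.sum_mul, hsum]
  gcongr
  exact key _ (by positivity)

section Trace

open Matrix

variable {ι : Type*} [Fintype ι] [DecidableEq ι]

theorem re_trace_mul_conjTranspose_mul_diagonal (B W : Matrix ι ι ℂ) (r : ι → ℝ) :
    (B * Wᴴ * diagonal (fun i => (r i : ℂ))).trace.re =
      ∑ k : ι × ι, r k.1 * (B k.1 k.2 * star (W k.1 k.2)).re := by
  rw [Fintype.sum_prod_type]
  simp only [trace, diag, mul_diagonal]
  simp only [mul_apply, conjTranspose_apply, Complex.re_sum, Complex.re_mul_ofReal,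
    Finset.sum_mul]
  exact Finset.sum_congr rfl fun i _ => Finset.sum_congr rfl fun j _ => mul_comm _ _

theorem re_trace_conjTranspose_mul_mul_diagonal (B : Matrix ι ι ℂ) (s : ι → ℝ) :
    (Bᴴ * B * diagonal (fun i => (s i : ℂ))).trace.re =
      ∑ k : ι × ι, s k.2 * Complex.normSq (B k.1 k.2) := by
  rw [Fintype.sum_prod_type_right]
  simp only [trace, diag, mul_diagonal]
  simp only [mul_apply, conjTranspose_apply, Complex.re_sum, Complex.re_mul_ofReal,
    Finset.sum_mul]
  refine Finset.sum_congr rfl fun i _ => Finset.sum_congr rfl fun j _ => ?_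
  simp [Complex.normSq_apply, mul_comm]

/-- Completing the square entrywise bounds a concave quadratic form in `B`, where `r` and `s` are
the spectra of two positive matrices and `W` is the overlap matrix of their eigenbases. -/
theorem two_mul_trace_sub_le_sum_sq_div (B W : Matrix ι ι ℂ) {r s : ι → ℝ}
    (hr : ∀ i, 0 ≤ r i) (hs : ∀ i, 0 ≤ s i) {t : ℝ} (ht : 0 < t) :
    2 * (B * Wᴴ * diagonal (fun i => (r i : ℂ))).trace.re -
        (Bᴴ * B * diagonal (fun i => (s i : ℂ))).trace.re -
        t * (B * Bᴴ * diagonal (fun i => (r i : ℂ))).trace.re ≤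
      ∑ k : ι × ι, (r k.1 * Complex.normSq (W k.1 k.2)) ^ 2 /
        (s k.2 * Complex.normSq (W k.1 k.2) + t * (r k.1 * Complex.normSq (W k.1 k.2))) := by
  rw [re_trace_mul_conjTranspose_mul_diagonal, re_trace_mul_conjTranspose_mul_diagonal,
    re_trace_conjTranspose_mul_mul_diagonal, Finset.mul_sum, Finset.mul_sum,
    ← Finset.sum_sub_distrib, ← Finset.sum_sub_distrib]
  refine Finset.sum_le_sum fun ⟨i, j⟩ _ => ?_
  have hre : (B i j * star (W i j)).re ≤ ‖B i j‖ * ‖W i j‖ := by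
    simpa using Complex.re_le_norm (B i j * star (W i j))
  have hB : (B i j * star (B i j)).re = ‖B i j‖ ^ 2 := by
    simp [← Complex.normSq_eq_norm_sq, Complex.normSq_apply]
  simp only [hB, Complex.normSq_eq_norm_sq]
  generalize (B i j * star (W i j)).re = x at hre
  have hb := norm_nonneg (B i j)
  have hc := norm_nonneg (W i j)
  generalize ‖B i j‖ = b at *
  generalize ‖W i j‖ = c at *
  have hri := hr i
  have hsj := hs j
  generalize r i = r at *
  generalize s j = s at *
  refine (show _ ≤ 2 * (r * (b * c)) - s * b ^ 2 - t * (r * b ^ 2) by gcongr).trans ?_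
  rcases hc.eq_or_lt with rfl | hc'
  · simp only [mul_zero]
    have : 0 ≤ s * b ^ 2 := by positivity
    have : 0 ≤ t * (r * b ^ 2) := by positivity
    simp
    linarith
  rcases hri.eq_or_lt with rfl | hr'
  · have : 0 ≤ s * b ^ 2 := by positivity
    simp
    linarith
  rw [le_div_iff₀ (by positivity)]
  nlinarith [mul_nonneg (sq_nonneg c) (sq_nonneg ((s + t * r) * b - r * c))]

open scoped MatrixOrder in
theorem _root_.Matrix.PosSemidef.exists_eq_conjTranspose_mul_self {A : Matrix ι ι ℂ}
    (hA : A.PosSemidef) : ∃ D : Matrix ι ι ℂ, A = Dᴴ * D :=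
  CStarAlgebra.nonneg_iff_eq_star_mul_self.mp hA.nonneg

theorem trace_mul_re_nonneg {A C : Matrix ι ι ℂ} (hA : A.PosSemidef) (hC : C.PosSemidef) :
    0 ≤ (A * C).trace.re := by
  obtain ⟨D, rfl⟩ := hA.exists_eq_conjTranspose_mul_self
  rw [Matrix.mul_assoc, Matrix.trace_mul_comm]
  exact (Complex.le_def.mp (hC.mul_mul_conjTranspose_same D).trace_nonneg).1

theorem trace_mul_eq_zero_of_suppLE {M ρ σ : Matrix ι ι ℂ} (hM : M.PosSemidef)
    (hσ : σ.PosSemidef) (hsupp : suppLE ρ σ) (h : (M * σ).trace.re = 0) :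
    (M * ρ).trace = 0 := by
  obtain ⟨D, rfl⟩ := hM.exists_eq_conjTranspose_mul_self
  obtain ⟨E, rfl⟩ := hσ.exists_eq_conjTranspose_mul_self
  rw [Matrix.mul_assoc, Matrix.trace_mul_comm] at h ⊢
  have hps := hσ.mul_mul_conjTranspose_same D
  have h0 : (D * (Eᴴ * E) * Dᴴ).trace = 0 :=
    Complex.ext h (Complex.le_def.mp hps.trace_nonneg).2.symm
  have h1 : (E * Dᴴ)ᴴ * (E * Dᴴ) = 0 := by
    rw [← hps.trace_eq_zero_iff.mp h0]
    simp [Matrix.mul_assoc]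
  have h2 : E * Dᴴ = 0 := Matrix.conjTranspose_mul_self_eq_zero.mp h1
  have h3 : ρ * Dᴴ = 0 := by
    ext i j
    have := congrFun (hsupp (fun k => Dᴴ k j) (by
      rw [← Matrix.mulVec_mulVec]
      have : E *ᵥ (fun k => Dᴴ k j) = 0 := funext fun i => congrFun (congrFun h2 i) j
      rw [this, Matrix.mulVec_zero])) i
    exact this
  rw [Matrix.mul_assoc, h3, Matrix.mul_zero, Matrix.trace_zero]

/-- Operator Jensen inequality for the square and a POVM, tested against a positive matrix. -/
theorem trace_sq_mul_le_sum {κ : Type*} [Fintype κ] {M : κ → Matrix ι ι ℂ}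
    (hM : ∀ x, (M x).PosSemidef) (hM1 : ∑ x, M x = 1) (a : κ → ℝ) {τ : Matrix ι ι ℂ}
    (hτ : τ.PosSemidef) :
    ((∑ x, (a x : ℂ) • M x) * (∑ x, (a x : ℂ) • M x) * τ).trace.re ≤
      ∑ x, a x ^ 2 * (M x * τ).trace.re := by
  set A := ∑ x, (a x : ℂ) • M x with hA
  have hAh : Aᴴ = A := by
    simp [hA, Matrix.conjTranspose_sum, (hM _).isHermitian.eq]
  have hexp : ∑ x, (A - (a x : ℂ) • (1 : Matrix ι ι ℂ)) * M x * (A - (a x : ℂ) • 1)ᴴ =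
      (∑ x, ((a x : ℂ) ^ 2) • M x) - A * A := by
    have hterm : ∀ x, (A - (a x : ℂ) • (1 : Matrix ι ι ℂ)) * M x * (A - (a x : ℂ) • 1)ᴴ =
        A * M x * A - A * ((a x : ℂ) • M x) - ((a x : ℂ) • M x) * A
          + ((a x : ℂ) ^ 2) • M x := by
      intro x
      simp only [Matrix.conjTranspose_sub, hAh, Matrix.conjTranspose_smul, sub_mul, mul_sub,
        Matrix.conjTranspose_one, smul_mul_assoc, mul_smul_comm, one_mul, mul_one,
        smul_sub, smul_smul, Complex.star_def, Complex.conj_ofReal, pow_two]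
      abel
    simp only [hterm, Finset.sum_add_distrib, Finset.sum_sub_distrib, ← Finset.mul_sum,
      ← Finset.sum_mul, ← hA, hM1, mul_one]
    abel
  have hnn : 0 ≤ (∑ x, (A - (a x : ℂ) • (1 : Matrix ι ι ℂ)) * M x * (A - (a x : ℂ) • 1)ᴴ
      * τ).trace.re := by
    rw [Matrix.trace_sum, Complex.re_sum]
    exact Finset.sum_nonneg fun x _ =>
      trace_mul_re_nonneg ((hM x).mul_mul_conjTranspose_same _) hτ
  rw [← Finset.sum_mul, hexp, sub_mul, Matrix.trace_sub, Complex.sub_re, Finset.sum_mul,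
    Matrix.trace_sum, Complex.re_sum, sub_nonneg] at hnn
  refine hnn.trans_eq (Finset.sum_congr rfl fun x _ => ?_)
  rw [smul_mul_assoc, Matrix.trace_smul, smul_eq_mul, ← Complex.ofReal_pow,
    Complex.re_ofReal_mul]

theorem isHermitian_eq_mul_diagonal_mul {A : Matrix ι ι ℂ} (hA : A.IsHermitian) :
    A = (hA.eigenvectorUnitary : Matrix ι ι ℂ) *
      diagonal (fun i => (hA.eigenvalues i : ℂ)) * (hA.eigenvectorUnitary : Matrix ι ι ℂ)ᴴ := by
  conv_lhs => rw [hA.spectral_theorem]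
  rfl

theorem matLog_of_isHermitian {A : Matrix ι ι ℂ} (hA : A.IsHermitian) :
    matLog A = (hA.eigenvectorUnitary : Matrix ι ι ℂ) *
      diagonal (fun i => (Real.logb 2 (hA.eigenvalues i) : ℂ)) *
        (hA.eigenvectorUnitary : Matrix ι ι ℂ)ᴴ := by
  rw [matLog, dif_pos hA]
  congr 3
  ext i
  split_ifs with h <;> simp [h]

theorem re_trace_mul_diagonal_mul_diagonal (U V : Matrix ι ι ℂ) (a b : ι → ℝ) :
    (U * diagonal (fun i => (a i : ℂ)) * Uᴴ *
        (V * diagonal (fun i => (b i : ℂ)) * Vᴴ)).trace.re =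
      ∑ k : ι × ι, a k.1 * b k.2 * Complex.normSq ((Uᴴ * V) k.1 k.2) := by
  have h : (U * diagonal (fun i => (a i : ℂ)) * Uᴴ *
        (V * diagonal (fun i => (b i : ℂ)) * Vᴴ)).trace =
      ((Uᴴ * V * diagonal (fun i => (b i : ℂ))) * (Uᴴ * V)ᴴ *
        diagonal (fun i => (a i : ℂ))).trace := by
    simp only [conjTranspose_mul, conjTranspose_conjTranspose, ← Matrix.mul_assoc]
    rw [Matrix.trace_mul_comm]
    simp only [← Matrix.mul_assoc]
    rw [Matrix.trace_mul_comm]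
    simp only [← Matrix.mul_assoc]
    rw [Matrix.trace_mul_comm]
    simp only [← Matrix.mul_assoc]
    rw [Matrix.trace_mul_comm]
    simp only [← Matrix.mul_assoc]
  rw [h, re_trace_mul_conjTranspose_mul_diagonal]
  refine Finset.sum_congr rfl fun k _ => ?_
  simp only [mul_diagonal, Complex.normSq_apply, Complex.star_def, Complex.mul_re, Complex.mul_im,
    Complex.conj_re, Complex.conj_im, Complex.ofReal_re, Complex.ofReal_im]
  ring

/-- Monotonicity of the relative entropy under a measurement, in natural units on the left. -/
theorem sum_re_trace_mul_log_div_le {κ : Type*} [Fintype κ] {M : κ → Matrix ι ι ℂ}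
    (hM : ∀ x, (M x).PosSemidef) (hM1 : ∑ x, M x = 1) {ρ σ : Matrix ι ι ℂ}
    (hρ : ρ.PosSemidef) (hσ : σ.PosSemidef) (hsupp : suppLE ρ σ) :
    ∑ x, (M x * ρ).trace.re * Real.log ((M x * ρ).trace.re / (M x * σ).trace.re) ≤
      Real.log 2 * (ρ * (matLog ρ - matLog σ)).trace.re := by
  have hlogρ := matLog_of_isHermitian hρ.isHermitian
  have hlogσ := matLog_of_isHermitian hσ.isHermitian
  have hρe := isHermitian_eq_mul_diagonal_mul hρ.isHermitian
  have hσe := isHermitian_eq_mul_diagonal_mul hσ.isHermitian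
  have hr := hρ.eigenvalues_nonneg
  have hs := hσ.eigenvalues_nonneg
  have hU := Matrix.mem_unitaryGroup_iff'.mp hρ.isHermitian.eigenvectorUnitary.2
  have hU' := Matrix.mem_unitaryGroup_iff.mp hρ.isHermitian.eigenvectorUnitary.2
  have hV := Matrix.mem_unitaryGroup_iff'.mp hσ.isHermitian.eigenvectorUnitary.2
  have hV' := Matrix.mem_unitaryGroup_iff.mp hσ.isHermitian.eigenvectorUnitary.2
  rw [star_eq_conjTranspose] at hU hU' hV hV'
  generalize hρ.isHermitian.eigenvalues = r at *
  generalize hσ.isHermitian.eigenvalues = s at *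
  generalize (hρ.isHermitian.eigenvectorUnitary : Matrix ι ι ℂ) = U at *
  generalize (hσ.isHermitian.eigenvectorUnitary : Matrix ι ι ℂ) = V at *
  have hPQ : ∀ k : ι × ι, s k.2 * Complex.normSq ((Uᴴ * V) k.1 k.2) = 0 →
      r k.1 * Complex.normSq ((Uᴴ * V) k.1 k.2) = 0 := by
    rintro ⟨i, j⟩ h
    rcases mul_eq_zero.mp h with h | h
    · have hσV : σ * V = V * diagonal (fun i => (s i : ℂ)) := by
        rw [hσe, Matrix.mul_assoc, hV, Matrix.mul_one]
      have hρV : Uᴴ * (ρ * V) = diagonal (fun i => (r i : ℂ)) * (Uᴴ * V) := by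
        rw [hρe]
        simp only [← Matrix.mul_assoc]
        rw [hU, Matrix.one_mul]
      have h1 : σ *ᵥ (fun k => V k j) = 0 := funext fun i => by
        have := congrFun (congrFun hσV i) j
        rwa [mul_diagonal, show s j = 0 from h, Complex.ofReal_zero, mul_zero] at this
      have h2 : Uᴴ *ᵥ (ρ *ᵥ fun k => V k j) = 0 := by rw [hsupp _ h1, mulVec_zero]
      have h3 := congrFun (congrFun hρV i) j
      rw [diagonal_mul] at h3
      have h4 : (r i : ℂ) * (Uᴴ * V) i j = 0 := by
        rw [← h3]
        exact congrFun h2 i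
      rcases mul_eq_zero.mp h4 with h5 | h5
      · simp [Complex.ofReal_eq_zero.mp h5]
      · simp [h5]
    · simp only at h
      simp [h]
  have hdiag_one : V * diagonal (fun _ => ((1 : ℝ) : ℂ)) * Vᴴ = 1 := by
    simp [hV']
  have hρ_trace : ρ.trace.re = ∑ k : ι × ι, r k.1 * Complex.normSq ((Uᴴ * V) k.1 k.2) := by
    have := re_trace_mul_diagonal_mul_diagonal U V r (fun _ => 1)
    rw [← hρe, hdiag_one, Matrix.mul_one] at this
    simpa only [mul_one] using this
  have hρ_log : (ρ * matLog ρ).trace.re = ∑ k : ι × ι,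
      r k.1 * Real.logb 2 (r k.1) * Complex.normSq ((Uᴴ * V) k.1 k.2) := by
    have := re_trace_mul_diagonal_mul_diagonal U V (fun i => r i * Real.logb 2 (r i))
      (fun _ => 1)
    rw [hdiag_one, Matrix.mul_one] at this
    simp only [mul_one] at this
    rw [← this, hlogρ]
    congr 2
    conv_lhs => rw [hρe]
    calc U * diagonal (fun i => (r i : ℂ)) * Uᴴ *
          (U * diagonal (fun i => (Real.logb 2 (r i) : ℂ)) * Uᴴ)
        = U * diagonal (fun i => (r i : ℂ)) * (Uᴴ * U) *
          diagonal (fun i => (Real.logb 2 (r i) : ℂ)) * Uᴴ := by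
          simp only [Matrix.mul_assoc]
      _ = _ := by
          rw [hU, Matrix.mul_one, Matrix.mul_assoc U, diagonal_mul_diagonal]
          simp only [Complex.ofReal_mul]
  have hσ_log : (ρ * matLog σ).trace.re = ∑ k : ι × ι,
      r k.1 * Real.logb 2 (s k.2) * Complex.normSq ((Uᴴ * V) k.1 k.2) := by
    rw [← re_trace_mul_diagonal_mul_diagonal U V r (fun j => Real.logb 2 (s j)), ← hρe, ← hlogσ]
  have hrhs : Real.log 2 * (ρ * (matLog ρ - matLog σ)).trace.re =
      ∑ k : ι × ι, r k.1 * Complex.normSq ((Uᴴ * V) k.1 k.2) *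
        Real.log (r k.1 * Complex.normSq ((Uᴴ * V) k.1 k.2) /
          (s k.2 * Complex.normSq ((Uᴴ * V) k.1 k.2))) := by
    rw [Matrix.mul_sub, Matrix.trace_sub, Complex.sub_re, hρ_log, hσ_log,
      ← Finset.sum_sub_distrib, Finset.mul_sum]
    refine Finset.sum_congr rfl fun k _ => ?_
    have hlog2 : Real.log 2 ≠ 0 := (Real.log_pos one_lt_two).ne'
    by_cases hP : r k.1 * Complex.normSq ((Uᴴ * V) k.1 k.2) = 0
    · rcases mul_eq_zero.mp hP with h | h <;> simp [h]
    · have hQ := mt (hPQ k) hP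
      rw [mul_div_mul_right _ _ (right_ne_zero_of_mul hP),
        Real.log_div (left_ne_zero_of_mul hP) (left_ne_zero_of_mul hQ), Real.logb, Real.logb]
      field_simp
  rw [hrhs]
  refine sum_mul_log_div_le_of_sum_sq_div_le (fun x => trace_mul_re_nonneg (hM x) hρ)
    (fun x => trace_mul_re_nonneg (hM x) hσ)
    (fun k => mul_nonneg (hr _) (Complex.normSq_nonneg _))
    (fun k => mul_nonneg (hs _) (Complex.normSq_nonneg _))
    (fun x h => by rw [trace_mul_eq_zero_of_suppLE (hM x) hσ hsupp h, Complex.zero_re])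
    hPQ ?_ ?_
  · rw [← hρ_trace, ← Complex.re_sum, ← Matrix.trace_sum, ← Finset.sum_mul, hM1, Matrix.one_mul]
  intro t ht
  refine le_trans ?_ (two_mul_trace_sub_le_sum_sq_div
    (Uᴴ * (∑ x, (((M x * ρ).trace.re / ((M x * σ).trace.re + t * (M x * ρ).trace.re) : ℝ) : ℂ) •
      M x) * V) (Uᴴ * V) hr hs ht)
  set a : κ → ℝ := fun x =>
    (M x * ρ).trace.re / ((M x * σ).trace.re + t * (M x * ρ).trace.re) with ha
  have hjρ := trace_sq_mul_le_sum hM hM1 a hρ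
  have hjσ := trace_sq_mul_le_sum hM hM1 a hσ
  set A := ∑ x, (a x : ℂ) • M x with hA
  have hAh : Aᴴ = A := by
    simp [hA, Matrix.conjTranspose_sum, (hM _).isHermitian.eq]
  have hlin : (A * ρ).trace.re = ∑ x, a x * (M x * ρ).trace.re := by
    simp [hA, Finset.sum_mul, Matrix.trace_sum]
  have e1 : (Uᴴ * A * V * (Uᴴ * V)ᴴ * diagonal (fun i => (r i : ℂ))).trace = (A * ρ).trace := by
    calc _ = (Uᴴ * (A * (V * Vᴴ) * U * diagonal (fun i => (r i : ℂ)))).trace := by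
          simp only [conjTranspose_mul, conjTranspose_conjTranspose, Matrix.mul_assoc]
      _ = (A * ρ).trace := by
          rw [hV', Matrix.mul_one, Matrix.trace_mul_comm]
          conv_rhs => rw [hρe]
          simp only [Matrix.mul_assoc]
  have e2 : ((Uᴴ * A * V)ᴴ * (Uᴴ * A * V) * diagonal (fun i => (s i : ℂ))).trace =
      (A * A * σ).trace := by
    calc _ = (Vᴴ * (A * (U * Uᴴ) * A * V * diagonal (fun i => (s i : ℂ)))).trace := by
          simp only [conjTranspose_mul, conjTranspose_conjTranspose, Matrix.mul_assoc, hAh]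
      _ = (A * A * σ).trace := by
          rw [hU', Matrix.mul_one, Matrix.trace_mul_comm]
          conv_rhs => rw [hσe]
          simp only [Matrix.mul_assoc]
  have e3 : (Uᴴ * A * V * (Uᴴ * A * V)ᴴ * diagonal (fun i => (r i : ℂ))).trace =
      (A * A * ρ).trace := by
    calc _ = (Uᴴ * (A * (V * Vᴴ) * A * U * diagonal (fun i => (r i : ℂ)))).trace := by
          simp only [conjTranspose_mul, conjTranspose_conjTranspose, Matrix.mul_assoc, hAh]
      _ = (A * A * ρ).trace := by
          rw [hV', Matrix.mul_one, Matrix.trace_mul_comm]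
          conv_rhs => rw [hρe]
          simp only [Matrix.mul_assoc]
  have hsq : ∑ x, (M x * ρ).trace.re ^ 2 / ((M x * σ).trace.re + t * (M x * ρ).trace.re) =
      2 * ∑ x, a x * (M x * ρ).trace.re - ∑ x, a x ^ 2 * (M x * σ).trace.re -
        t * ∑ x, a x ^ 2 * (M x * ρ).trace.re := by
    rw [Finset.mul_sum, Finset.mul_sum, ← Finset.sum_sub_distrib, ← Finset.sum_sub_distrib]
    refine Finset.sum_congr rfl fun x _ => ?_
    by_cases hD : (M x * σ).trace.re + t * (M x * ρ).trace.re = 0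
    · simp [ha, hD]
    · simp only [ha]
      generalize (M x * ρ).trace.re = y at *
      generalize (M x * σ).trace.re = z at *
      rw [← sub_eq_zero]
      field_simp
      ring
  rw [e1, e2, e3, hlin, hsq]
  gcongr

end Trace

/-- for every finite POVM, the KL divergence of the outcome distributions is at
most the Umegaki relative entropy; consequently `D_M(ρ‖σ) ≤ D(ρ‖σ)`. -/
theorem measured_le_umegaki {d : ℕ} (ρ σ : Matrix (Fin d) (Fin d) ℂ)
    (hρ : ρ.PosSemidef) (hρ1 : ρ.trace = 1) (hσ : σ.PosSemidef)
    (hsupp : suppLE ρ σ) :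
    (∀ (m : ℕ) (M : Fin m → Matrix (Fin d) (Fin d) ℂ), IsPOVM M →
      (∑ x, klTerm ((M x * ρ).trace).re ((M x * σ).trace).re) ≤ relEnt ρ σ) ∧
    measRelEnt ρ σ ≤ relEnt ρ σ := by
  have key : ∀ (m : ℕ) (M : Fin m → Matrix (Fin d) (Fin d) ℂ), IsPOVM M →
      (∑ x, klTerm ((M x * ρ).trace).re ((M x * σ).trace).re) ≤ relEnt ρ σ := by
    intro m M hM
    have hterm : ∀ x, klTerm ((M x * ρ).trace).re ((M x * σ).trace).re =
        (((M x * ρ).trace.re *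
          Real.logb 2 ((M x * ρ).trace.re / (M x * σ).trace.re) : ℝ) : EReal) := by
      intro x
      rw [klTerm]
      split_ifs with h1 h2
      · simp [h1]
      · exact absurd (by rw [trace_mul_eq_zero_of_suppLE (hM.1 x) hσ hsupp h2, Complex.zero_re]) h1
      · rfl
    have hreal := sum_re_trace_mul_log_div_le hM.1 hM.2 hρ hσ hsupp
    simp only [hterm]
    rw [relEnt, if_pos hsupp, ← ereal_coe_sum, EReal.coe_le_coe_iff]
    simp only [Real.logb, mul_div_assoc', ← Finset.sum_div]
    rw [div_le_iff₀ (Real.log_pos one_lt_two), mul_comm _ (Real.log 2)]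
    exact hreal
  exact ⟨key, iSup_le fun m => iSup_le fun M => iSup_le fun hM => key m M hM⟩

end QIT
end
end

section
/- Let d, m ≥ 1, let A be a convex, compact, permutation-invariant set of density matrices on (ℂ^d)^{⊗m} and let B be a convex, compact, permutation-invariant set of positive semidefinite matrices on (ℂ^d)^{⊗m}. Then D(A‖B) = D(A ∩ I_m ‖ B ∩ I_m) and D_M(A‖B) = D_M(A ∩ I_m ‖ B ∩ I_m), where I_m is the set of permutation-invariant operators. -/
open scoped Kronecker ComplexOrder Matrix

attribute [local instance] Classical.propDecidable

noncomputable section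

namespace QIT

variable {n : Type*} [Fintype n] [DecidableEq n]

/-- A set of matrices on `(ℂ^d)^{⊗m}` is permutation invariant. -/
def PermInvSet (d m : ℕ) (S : Set (Matrix (Fin m → Fin d) (Fin m → Fin d) ℂ)) : Prop :=
  ∀ π : Equiv.Perm (Fin m),
    (fun X => permMat d m π * X * (permMat d m π)ᴴ) '' S = S

/-- The algebra `I_m` of permutation-invariant operators on `(ℂ^d)^{⊗m}`. -/
def invariantOps (d m : ℕ) : Set (Matrix (Fin m → Fin d) (Fin m → Fin d) ℂ) :=
  {X | ∀ π : Equiv.Perm (Fin m), permMat d m π * X * (permMat d m π)ᴴ = X}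

/-- Umegaki relative entropy between two sets of matrices. -/
def relEntSet {I : Type*} [Fintype I] [DecidableEq I]
    (A B : Set (Matrix I I ℂ)) : EReal :=
  ⨅ ρ ∈ A, ⨅ σ ∈ B, relEnt ρ σ

/-- Measured relative entropy between two sets of matrices. -/
def measRelEntSet {I : Type*} [Fintype I] [DecidableEq I]
    (A B : Set (Matrix I I ℂ)) : EReal :=
  ⨅ ρ ∈ A, ⨅ σ ∈ B, measRelEnt ρ σ

/-- The average of the conjugates of `X` by the members of a finite family of matrices. -/
def twirl {G : Type*} [Fintype G] (U : G → Matrix n n ℂ) (X : Matrix n n ℂ) : Matrix n n ℂ :=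
  (Fintype.card G : ℝ)⁻¹ • ∑ g, U g * X * (U g)ᴴ

/-- For each `Y`, a function of the pair `(ρ, σ)` that is real linear; the supremum over `Y`
is the resolvent quadratic form appearing in the integral representation of relative entropy. -/
def resolventForm (s : ℝ) (ρ σ Y : Matrix n n ℂ) : ℝ :=
  2 * (Yᴴ * ρ).trace.re - (Y * σ * Yᴴ).trace.re - s * (Yᴴ * ρ * Y).trace.re

/-- The maximum over `Y` of `resolventForm s ρ σ Y`, where `ρ` and `σ` have eigenvalues `p` and `q`
and `W` is the matrix of overlaps of their eigenbases. -/
def resolventMax (s : ℝ) (p q : n → ℝ) (W : Matrix n n ℂ) : ℝ :=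
  ∑ i, ∑ j, p i ^ 2 * Complex.normSq (W i j) / (q j + s * p i)

section Spectral

variable {U V : Matrix n n ℂ} {p q : n → ℝ}

theorem trace_diagonal_mul_diagonal (a b : n → ℝ) (U V : Matrix n n ℂ) :
    (U * Matrix.diagonal (fun i => (a i : ℂ)) * Uᴴ *
      (V * Matrix.diagonal (fun i => (b i : ℂ)) * Vᴴ)).trace.re =
    ∑ i, ∑ j, a i * b j * Complex.normSq ((Uᴴ * V) i j) := by
  have h : (U * Matrix.diagonal (fun i => (a i : ℂ)) * Uᴴ *
      (V * Matrix.diagonal (fun i => (b i : ℂ)) * Vᴴ)).trace =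
      (Matrix.diagonal (fun i => (a i : ℂ)) * ((Uᴴ * V) *
        Matrix.diagonal (fun i => (b i : ℂ)) * (Uᴴ * V)ᴴ)).trace := by
    rw [Matrix.mul_assoc U, Matrix.mul_assoc U, Matrix.trace_mul_comm]
    simp only [Matrix.conjTranspose_mul, Matrix.conjTranspose_conjTranspose, Matrix.mul_assoc]
  rw [h, Matrix.trace, Complex.re_sum]
  refine Finset.sum_congr rfl fun i _ => ?_
  rw [Matrix.diag_apply, Matrix.diagonal_mul, Matrix.mul_apply, Finset.mul_sum, Complex.re_sum]
  refine Finset.sum_congr rfl fun j _ => ?_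
  rw [Matrix.mul_diagonal, Matrix.conjTranspose_apply]
  simp only [Complex.mul_re, Complex.mul_im, Complex.ofReal_re, Complex.ofReal_im,
    Complex.star_def, Complex.conj_re, Complex.conj_im, Complex.normSq_apply]
  ring

theorem resolventForm_eq (hU : Uᴴ * U = 1) (hV : Vᴴ * V = 1) (s : ℝ) (Z : Matrix n n ℂ) :
    resolventForm s (U * Matrix.diagonal (fun i => (p i : ℂ)) * Uᴴ)
      (V * Matrix.diagonal (fun i => (q i : ℂ)) * Vᴴ) (U * Z * Vᴴ) =
    ∑ i, ∑ j, (2 * p i * (star (Z i j) * (Uᴴ * V) i j).re -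
      (q j + s * p i) * Complex.normSq (Z i j)) := by
  have h1 : ((U * Z * Vᴴ)ᴴ * (U * Matrix.diagonal (fun i => (p i : ℂ)) * Uᴴ)).trace =
      (Zᴴ * (Matrix.diagonal (fun i => (p i : ℂ)) * (Uᴴ * V))).trace := by
    have : (U * Z * Vᴴ)ᴴ * (U * Matrix.diagonal (fun i => (p i : ℂ)) * Uᴴ) =
        V * (Zᴴ * ((Uᴴ * U) * (Matrix.diagonal (fun i => (p i : ℂ)) * Uᴴ))) := by
      simp only [Matrix.conjTranspose_mul, Matrix.conjTranspose_conjTranspose, Matrix.mul_assoc]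
    rw [this, hU, Matrix.one_mul, Matrix.trace_mul_comm]
    simp only [Matrix.mul_assoc]
  have h2 : ((U * Z * Vᴴ) * (V * Matrix.diagonal (fun i => (q i : ℂ)) * Vᴴ) *
      (U * Z * Vᴴ)ᴴ).trace = (Z * Matrix.diagonal (fun i => (q i : ℂ)) * Zᴴ).trace := by
    have : (U * Z * Vᴴ) * (V * Matrix.diagonal (fun i => (q i : ℂ)) * Vᴴ) * (U * Z * Vᴴ)ᴴ =
        U * (Z * ((Vᴴ * V) * (Matrix.diagonal (fun i => (q i : ℂ)) *
          ((Vᴴ * V) * (Zᴴ * Uᴴ))))) := by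
      simp only [Matrix.conjTranspose_mul, Matrix.conjTranspose_conjTranspose, Matrix.mul_assoc]
    rw [this, hV, Matrix.one_mul, Matrix.one_mul, Matrix.trace_mul_comm]
    simp only [Matrix.mul_assoc, hU, Matrix.mul_one]
  have h3 : ((U * Z * Vᴴ)ᴴ * (U * Matrix.diagonal (fun i => (p i : ℂ)) * Uᴴ) *
      (U * Z * Vᴴ)).trace = (Matrix.diagonal (fun i => (p i : ℂ)) * (Z * Zᴴ)).trace := by
    have : (U * Z * Vᴴ)ᴴ * (U * Matrix.diagonal (fun i => (p i : ℂ)) * Uᴴ) * (U * Z * Vᴴ) =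
        V * (Zᴴ * ((Uᴴ * U) * (Matrix.diagonal (fun i => (p i : ℂ)) *
          ((Uᴴ * U) * (Z * Vᴴ))))) := by
      simp only [Matrix.conjTranspose_mul, Matrix.conjTranspose_conjTranspose, Matrix.mul_assoc]
    rw [this, hU, Matrix.one_mul, Matrix.one_mul, Matrix.trace_mul_comm]
    simp only [Matrix.mul_assoc, hV, Matrix.mul_one]
    rw [Matrix.trace_mul_comm]
    simp only [Matrix.mul_assoc]
  rw [resolventForm, h1, h2, h3, Matrix.trace_mul_comm Zᴴ]
  simp only [Matrix.trace, Matrix.diag_apply, Complex.re_sum, Finset.mul_sum,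
    ← Finset.sum_sub_distrib]
  refine Finset.sum_congr rfl fun i _ => ?_
  rw [Matrix.diagonal_mul, Matrix.mul_apply, Matrix.mul_apply, Matrix.mul_apply, Finset.mul_sum]
  simp only [Complex.re_sum, Finset.mul_sum, ← Finset.sum_sub_distrib]
  refine Finset.sum_congr rfl fun j _ => ?_
  rw [Matrix.mul_diagonal, Matrix.diagonal_mul, Matrix.conjTranspose_apply]
  simp only [Complex.mul_re, Complex.mul_im, Complex.ofReal_re, Complex.ofReal_im,
    Complex.star_def, Complex.conj_re, Complex.conj_im, Complex.normSq_apply]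
  ring

theorem resolventForm_le (hU : Uᴴ * U = 1) (hU' : U * Uᴴ = 1) (hV : Vᴴ * V = 1)
    (hV' : V * Vᴴ = 1) (hp : ∀ i, 0 ≤ p i) (hq : ∀ i, 0 ≤ q i) {s : ℝ} (hs : 0 < s)
    (Y : Matrix n n ℂ) :
    resolventForm s (U * Matrix.diagonal (fun i => (p i : ℂ)) * Uᴴ)
      (V * Matrix.diagonal (fun i => (q i : ℂ)) * Vᴴ) Y ≤ resolventMax s p q (Uᴴ * V) := by
  have hY : Y = U * (Uᴴ * Y * V) * Vᴴ := by
    have : U * (Uᴴ * Y * V) * Vᴴ = (U * Uᴴ) * Y * (V * Vᴴ) := by simp only [Matrix.mul_assoc]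
    rw [this, hU', hV', Matrix.one_mul, Matrix.mul_one]
  rw [hY, resolventForm_eq hU hV]
  refine Finset.sum_le_sum fun i _ => Finset.sum_le_sum fun j _ => ?_
  generalize (Uᴴ * Y * V) i j = z
  generalize (Uᴴ * V) i j = w
  rcases (hp i).eq_or_lt with h0 | hpos
  · rw [← h0]
    have := mul_nonneg (hq j) (Complex.normSq_nonneg z)
    simpa using this
  · have hc : 0 < q j + s * p i := add_pos_of_nonneg_of_pos (hq j) (mul_pos hs hpos)
    rw [le_div_iff₀ hc]
    simp only [Complex.mul_re, Complex.star_def, Complex.conj_re, Complex.conj_im,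
      Complex.normSq_apply]
    nlinarith [sq_nonneg ((q j + s * p i) * z.re - p i * w.re),
      sq_nonneg ((q j + s * p i) * z.im - p i * w.im)]

theorem exists_resolventForm_eq (hU : Uᴴ * U = 1) (hV : Vᴴ * V = 1)
    (hp : ∀ i, 0 ≤ p i) (hq : ∀ i, 0 ≤ q i) {s : ℝ} (hs : 0 < s) :
    ∃ Y, resolventForm s (U * Matrix.diagonal (fun i => (p i : ℂ)) * Uᴴ)
      (V * Matrix.diagonal (fun i => (q i : ℂ)) * Vᴴ) Y = resolventMax s p q (Uᴴ * V) := by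
  refine ⟨U * (Matrix.of fun i j =>
    ((p i / (q j + s * p i) : ℝ) : ℂ) * (Uᴴ * V) i j) * Vᴴ, ?_⟩
  rw [resolventForm_eq hU hV]
  refine Finset.sum_congr rfl fun i _ => Finset.sum_congr rfl fun j _ => ?_
  rw [Matrix.of_apply]
  generalize (Uᴴ * V) i j = w
  rcases (hp i).eq_or_lt with h0 | hpos
  · simp [← h0]
  · have hc : 0 < q j + s * p i := add_pos_of_nonneg_of_pos (hq j) (mul_pos hs hpos)
    simp only [Complex.mul_re, Complex.mul_im, Complex.ofReal_re, Complex.ofReal_im,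
      Complex.star_def, Complex.conj_re, Complex.conj_im, Complex.normSq_apply]
    generalize q j + s * p i = c at hc
    field_simp
    ring

theorem suppLE.overlap_eq_zero (hU : Uᴴ * U = 1) (hV : Vᴴ * V = 1)
    (h : suppLE (U * Matrix.diagonal (fun i => (p i : ℂ)) * Uᴴ)
      (V * Matrix.diagonal (fun i => (q i : ℂ)) * Vᴴ)) {i j : n} (hp : p i ≠ 0)
    (hq : q j = 0) : (Uᴴ * V) i j = 0 := by
  have h1 : (V * Matrix.diagonal (fun i => (q i : ℂ)) * Vᴴ).mulVec
      (V.mulVec (Pi.single j 1)) = 0 := by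
    rw [Matrix.mulVec_mulVec, Matrix.mul_assoc, hV, Matrix.mul_one, ← Matrix.mulVec_mulVec,
      Matrix.diagonal_mulVec_single, hq]
    simp
  have h2 : Uᴴ.mulVec ((U * Matrix.diagonal (fun i => (p i : ℂ)) * Uᴴ).mulVec
      (V.mulVec (Pi.single j 1))) i = 0 := by
    rw [h _ h1, Matrix.mulVec_zero, Pi.zero_apply]
  have h3 : Uᴴ * (U * Matrix.diagonal (fun i => (p i : ℂ)) * Uᴴ * V) =
      Matrix.diagonal (fun i => (p i : ℂ)) * (Uᴴ * V) := by
    have : Uᴴ * (U * Matrix.diagonal (fun i => (p i : ℂ)) * Uᴴ * V) =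
      (Uᴴ * U) * (Matrix.diagonal (fun i => (p i : ℂ)) * (Uᴴ * V)) := by
        simp only [Matrix.mul_assoc]
    rw [this, hU, Matrix.one_mul]
  rw [Matrix.mulVec_mulVec, Matrix.mulVec_mulVec, Matrix.mul_assoc Uᴴ, h3,
    Matrix.mulVec_single_one] at h2
  simpa [Matrix.diagonal_mul, hp] using h2

end Spectral

section ScalarIntegral

/-- The integral of `resolventMax` over `[0, T]`. -/
def resolventIntegral (T : ℝ) (p q : n → ℝ) (W : Matrix n n ℂ) : ℝ :=
  ∑ i, ∑ j, p i * Complex.normSq (W i j) * (Real.log (q j + T * p i) - Real.log (q j))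

variable {p q : n → ℝ} {W : Matrix n n ℂ}

omit [DecidableEq n] in
theorem hasDerivAt_resolventIntegral (hp : ∀ i, 0 ≤ p i) (hq : ∀ i, 0 ≤ q i)
    (h0 : ∀ i j, p i ≠ 0 → q j = 0 → W i j = 0) {T : ℝ} (hT : 0 ≤ T) :
    HasDerivAt (fun T => resolventIntegral T p q W) (resolventMax T p q W) T := by
  unfold resolventIntegral resolventMax
  refine HasDerivAt.fun_sum fun i _ => HasDerivAt.fun_sum fun j _ => ?_
  rcases (hp i).eq_or_lt with hpi | hpi
  · simpa [← hpi] using hasDerivAt_const T (0 : ℝ)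
  rcases (hq j).eq_or_lt with hqj | hqj
  · simpa [h0 i j hpi.ne' hqj.symm] using hasDerivAt_const T (0 : ℝ)
  have hc : q j + T * p i ≠ 0 := by positivity
  have h1 : HasDerivAt (fun T => q j + T * p i) (p i) T := by
    simpa using ((hasDerivAt_id T).mul_const (p i)).const_add (q j)
  refine (((h1.log hc).sub_const (Real.log (q j))).const_mul
    (p i * Complex.normSq (W i j))).congr_deriv ?_
  ring

omit [DecidableEq n] in
theorem tendsto_resolventIntegral (hp : ∀ i, 0 ≤ p i) :
    Filter.Tendsto (fun T => resolventIntegral T p q W -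
        Real.log T * ∑ i, ∑ j, p i * Complex.normSq (W i j)) Filter.atTop
      (nhds (∑ i, ∑ j, p i * Complex.normSq (W i j) * (Real.log (p i) - Real.log (q j)))) := by
  simp only [resolventIntegral, Finset.mul_sum, ← Finset.sum_sub_distrib]
  refine tendsto_finsetSum _ fun i _ => tendsto_finsetSum _ fun j _ => ?_
  rcases (hp i).eq_or_lt with hpi | hpi
  · simp [← hpi]
  have h1 : Filter.Tendsto (fun T : ℝ => q j / T + p i) Filter.atTop (nhds (p i)) := by
    simpa using (Filter.Tendsto.const_div_atTop Filter.tendsto_id (q j)).add_const (p i)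
  have h2 := ((h1.log hpi.ne').sub_const (Real.log (q j))).const_mul
    (p i * Complex.normSq (W i j))
  refine h2.congr' ?_
  filter_upwards [Filter.eventually_gt_atTop 0,
    h1.eventually_ne hpi.ne'] with T hT hne
  have : q j + T * p i = T * (q j / T + p i) := by field_simp
  rw [this, Real.log_mul hT.ne' hne]
  ring

omit [DecidableEq n] in
theorem entropySum_le_of_resolventMax_le {p' q' : n → ℝ} {W' : Matrix n n ℂ}
    (hp : ∀ i, 0 ≤ p i) (hq : ∀ i, 0 ≤ q i) (h0 : ∀ i j, p i ≠ 0 → q j = 0 → W i j = 0)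
    (hp' : ∀ i, 0 ≤ p' i) (hq' : ∀ i, 0 ≤ q' i)
    (h0' : ∀ i j, p' i ≠ 0 → q' j = 0 → W' i j = 0)
    (hmass : ∑ i, ∑ j, p i * Complex.normSq (W i j) =
      ∑ i, ∑ j, p' i * Complex.normSq (W' i j))
    (hle : ∀ s, 0 < s → resolventMax s p q W ≤ resolventMax s p' q' W') :
    ∑ i, ∑ j, p i * Complex.normSq (W i j) * (Real.log (p i) - Real.log (q j)) ≤
      ∑ i, ∑ j, p' i * Complex.normSq (W' i j) * (Real.log (p' i) - Real.log (q' j)) := by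
  have hd : ∀ T : ℝ, 0 ≤ T → HasDerivAt
      (fun T => resolventIntegral T p' q' W' - resolventIntegral T p q W)
      (resolventMax T p' q' W' - resolventMax T p q W) T := fun T hT =>
    (hasDerivAt_resolventIntegral hp' hq' h0' hT).sub
      (hasDerivAt_resolventIntegral hp hq h0 hT)
  have hmono : MonotoneOn
      (fun T => resolventIntegral T p' q' W' - resolventIntegral T p q W) (Set.Ici 0) := by
    refine monotoneOn_of_deriv_nonneg (convex_Ici 0)
      (fun T hT => (hd T hT).continuousAt.continuousWithinAt) ?_ ?_
    · rw [interior_Ici]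
      exact fun T hT => (hd T (le_of_lt hT)).differentiableAt.differentiableWithinAt
    · rw [interior_Ici]
      intro T hT
      rw [(hd T (le_of_lt hT)).deriv]
      exact sub_nonneg.2 (hle T hT)
  refine le_of_tendsto_of_tendsto (tendsto_resolventIntegral hp)
    (tendsto_resolventIntegral hp') ?_
  filter_upwards [Filter.eventually_ge_atTop 0] with T hT
  have := hmono (Set.mem_Ici.2 le_rfl) (Set.mem_Ici.2 hT) hT
  simp only [resolventIntegral, zero_mul, add_zero, sub_self, mul_zero,
    Finset.sum_const_zero] at this
  rw [hmass]
  exact sub_le_sub_right (sub_nonneg.1 this) _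

end ScalarIntegral

section Eigen

theorem eq_eigenvectorUnitary_mul_diagonal {A : Matrix n n ℂ} (hA : A.IsHermitian) :
    A = (hA.eigenvectorUnitary : Matrix n n ℂ) *
      Matrix.diagonal (fun i => (hA.eigenvalues i : ℂ)) *
        (hA.eigenvectorUnitary : Matrix n n ℂ)ᴴ := by
  conv_lhs => rw [hA.spectral_theorem]
  rfl

theorem matLog_eq {A : Matrix n n ℂ} (hA : A.IsHermitian) :
    matLog A = (hA.eigenvectorUnitary : Matrix n n ℂ) *
      Matrix.diagonal (fun i => ((Real.logb 2 (hA.eigenvalues i) : ℝ) : ℂ)) *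
        (hA.eigenvectorUnitary : Matrix n n ℂ)ᴴ := by
  rw [matLog, dif_pos hA]
  congr 3
  ext i
  split_ifs with h <;> simp [h]

theorem conjTranspose_eigenvectorUnitary_mul_self {A : Matrix n n ℂ} (hA : A.IsHermitian) :
    (hA.eigenvectorUnitary : Matrix n n ℂ)ᴴ * hA.eigenvectorUnitary = 1 :=
  Unitary.coe_star_mul_self hA.eigenvectorUnitary

theorem eigenvectorUnitary_mul_conjTranspose_self {A : Matrix n n ℂ} (hA : A.IsHermitian) :
    (hA.eigenvectorUnitary : Matrix n n ℂ) * (hA.eigenvectorUnitary : Matrix n n ℂ)ᴴ = 1 :=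
  Unitary.coe_mul_star_self hA.eigenvectorUnitary

theorem trace_re_eq_sum_overlap {ρ σ : Matrix n n ℂ} (hρ : ρ.IsHermitian) (hσ : σ.IsHermitian) :
    ρ.trace.re = ∑ i, ∑ j, hρ.eigenvalues i * Complex.normSq
      (((hρ.eigenvectorUnitary : Matrix n n ℂ)ᴴ * hσ.eigenvectorUnitary) i j) := by
  have h := trace_diagonal_mul_diagonal hρ.eigenvalues (fun _ => 1)
    (hρ.eigenvectorUnitary : Matrix n n ℂ) (hσ.eigenvectorUnitary : Matrix n n ℂ)
  simpa only [← eq_eigenvectorUnitary_mul_diagonal, Complex.ofReal_one, Matrix.diagonal_one,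
    Matrix.mul_one, eigenvectorUnitary_mul_conjTranspose_self, mul_one] using h

theorem trace_mul_matLog_sub_re {ρ σ : Matrix n n ℂ} (hρ : ρ.IsHermitian)
    (hσ : σ.IsHermitian) :
    (ρ * (matLog ρ - matLog σ)).trace.re = (∑ i, ∑ j, hρ.eigenvalues i * Complex.normSq
      (((hρ.eigenvectorUnitary : Matrix n n ℂ)ᴴ * hσ.eigenvectorUnitary) i j) *
        (Real.log (hρ.eigenvalues i) - Real.log (hσ.eigenvalues j))) / Real.log 2 := by
  have h1 := trace_diagonal_mul_diagonal
    (fun i => hρ.eigenvalues i * Real.logb 2 (hρ.eigenvalues i)) (fun _ => 1)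
    (hρ.eigenvectorUnitary : Matrix n n ℂ) (hσ.eigenvectorUnitary : Matrix n n ℂ)
  have h2 := trace_diagonal_mul_diagonal hρ.eigenvalues
    (fun j => Real.logb 2 (hσ.eigenvalues j))
    (hρ.eigenvectorUnitary : Matrix n n ℂ) (hσ.eigenvectorUnitary : Matrix n n ℂ)
  have h3 : ρ * matLog ρ = (hρ.eigenvectorUnitary : Matrix n n ℂ) * Matrix.diagonal (fun i =>
      ((hρ.eigenvalues i * Real.logb 2 (hρ.eigenvalues i) : ℝ) : ℂ)) *
        (hρ.eigenvectorUnitary : Matrix n n ℂ)ᴴ := by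
    rw [matLog_eq hρ]
    conv_lhs => enter [1]; rw [eq_eigenvectorUnitary_mul_diagonal hρ]
    set U := (hρ.eigenvectorUnitary : Matrix n n ℂ)
    set D := Matrix.diagonal (fun i => (hρ.eigenvalues i : ℂ))
    set E := Matrix.diagonal (fun i => ((Real.logb 2 (hρ.eigenvalues i) : ℝ) : ℂ))
    have h4 : U * D * Uᴴ * (U * E * Uᴴ) = U * (D * ((Uᴴ * U) * E)) * Uᴴ := by
      simp only [Matrix.mul_assoc]
    rw [h4, conjTranspose_eigenvectorUnitary_mul_self, Matrix.one_mul,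
      Matrix.diagonal_mul_diagonal]
    simp only [Complex.ofReal_mul]
  rw [← h3] at h1
  rw [← matLog_eq, ← eq_eigenvectorUnitary_mul_diagonal] at h2
  simp only [Complex.ofReal_one, Matrix.diagonal_one,
    eigenvectorUnitary_mul_conjTranspose_self, mul_one] at h1
  rw [Matrix.mul_sub, Matrix.trace_sub, Complex.sub_re, h1, h2, ← Finset.sum_sub_distrib,
    Finset.sum_div]
  refine Finset.sum_congr rfl fun i _ => ?_
  rw [← Finset.sum_sub_distrib, Finset.sum_div]
  refine Finset.sum_congr rfl fun j _ => ?_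
  simp only [Real.logb]
  ring

end Eigen

section Twirl

variable {G : Type*} [Fintype G] {U : G → Matrix n n ℂ}

omit [DecidableEq n] in
theorem PosSemidef.twirl {X : Matrix n n ℂ} (hX : X.PosSemidef) : (twirl U X).PosSemidef := by
  refine Matrix.PosSemidef.smul (Matrix.posSemidef_sum _ fun g _ =>
    hX.mul_mul_conjTranspose_same (U g)) ?_
  positivity

omit [DecidableEq n] in
theorem trace_mul_twirl_re (M X : Matrix n n ℂ) :
    (M * twirl U X).trace.re = (twirl (fun g => (U g)ᴴ) M * X).trace.re := by
  simp only [twirl, Matrix.mul_smul, Matrix.smul_mul, Matrix.mul_sum, Matrix.sum_mul,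
    Matrix.trace_smul, Matrix.trace_sum]
  congr 2
  refine Finset.sum_congr rfl fun g _ => ?_
  rw [← Matrix.mul_assoc, Matrix.trace_mul_comm]
  simp only [Matrix.conjTranspose_conjTranspose, Matrix.mul_assoc]

theorem twirl_one [Nonempty G] (hU : ∀ g, U g * (U g)ᴴ = 1) : twirl U 1 = 1 := by
  simp [twirl, hU, ← Nat.cast_smul_eq_nsmul ℝ, smul_smul]

omit [DecidableEq n] in
theorem twirl_sum {ι : Type*} (s : Finset ι) (X : ι → Matrix n n ℂ) :
    twirl U (∑ x ∈ s, X x) = ∑ x ∈ s, twirl U (X x) := by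
  simp only [twirl, Matrix.mul_sum, Matrix.sum_mul, ← Finset.smul_sum]
  rw [Finset.sum_comm]

theorem measRelEnt_twirl_le [Nonempty G] (hU : ∀ g, (U g)ᴴ * U g = 1) (ρ σ : Matrix n n ℂ) :
    measRelEnt (twirl U ρ) (twirl U σ) ≤ measRelEnt ρ σ := by
  refine iSup_le fun m => iSup_le fun M => iSup_le fun hM => ?_
  simp only [trace_mul_twirl_re]
  have hM' : IsPOVM fun x => twirl (fun g => (U g)ᴴ) (M x) := by
    refine ⟨fun x => PosSemidef.twirl (hM.1 x), ?_⟩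
    rw [← twirl_sum, hM.2, twirl_one]
    simpa using hU
  exact le_iSup_of_le m (le_iSup_of_le _ (le_iSup_of_le hM' le_rfl))

theorem trace_twirl_re [Nonempty G] (hU : ∀ g, (U g)ᴴ * U g = 1) (X : Matrix n n ℂ) :
    (twirl U X).trace.re = X.trace.re := by
  have h := trace_mul_twirl_re (U := U) 1 X
  rwa [twirl_one (by simpa using hU), Matrix.one_mul, Matrix.one_mul] at h

omit [DecidableEq n] in
theorem suppLE.twirl {ρ σ : Matrix n n ℂ} (hσ : σ.PosSemidef) (h : suppLE ρ σ) :
    suppLE (twirl U ρ) (twirl U σ) := by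
  intro x hx
  rcases isEmpty_or_nonempty G with hG | hG
  · simp [QIT.twirl]
  have hsum : ∑ g, star x ⬝ᵥ (U g * σ * (U g)ᴴ).mulVec x = 0 := by
    rw [QIT.twirl, Matrix.smul_mulVec, smul_eq_zero] at hx
    have hx' := hx.resolve_left (by simp)
    rw [← dotProduct_sum, ← Matrix.sum_mulVec, hx', dotProduct_zero]
  have hpsd : ∀ g, (U g * σ * (U g)ᴴ).PosSemidef := fun g =>
    hσ.mul_mul_conjTranspose_same (U g)
  rw [Finset.sum_eq_zero_iff_of_nonneg fun g _ => (hpsd g).dotProduct_mulVec_nonneg x] at hsum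
  rw [QIT.twirl, Matrix.smul_mulVec, Matrix.sum_mulVec, Finset.sum_eq_zero, smul_zero]
  intro g hg
  have h1 : star ((U g)ᴴ.mulVec x) ⬝ᵥ σ.mulVec ((U g)ᴴ.mulVec x) = 0 := by
    rw [← hsum g hg, Matrix.star_mulVec, Matrix.conjTranspose_conjTranspose,
      ← Matrix.dotProduct_mulVec, Matrix.mulVec_mulVec, Matrix.mulVec_mulVec]
  rw [Matrix.mul_assoc, ← Matrix.mulVec_mulVec, ← Matrix.mulVec_mulVec,
    h _ ((hσ.dotProduct_mulVec_zero_iff _).1 h1), Matrix.mulVec_zero]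

theorem resolventForm_twirl (hU' : ∀ g, U g * (U g)ᴴ = 1)
    (s : ℝ) (ρ σ Y : Matrix n n ℂ) :
    resolventForm s (twirl U ρ) (twirl U σ) Y =
      (Fintype.card G : ℝ)⁻¹ * ∑ g, resolventForm s ρ σ ((U g)ᴴ * Y * U g) := by
  have h1 : ∀ g, (((U g)ᴴ * Y * U g)ᴴ * ρ).trace = (Yᴴ * (U g * ρ * (U g)ᴴ)).trace := by
    intro g
    rw [← Matrix.mul_assoc Yᴴ, Matrix.trace_mul_comm _ (U g)ᴴ]
    simp only [Matrix.conjTranspose_mul, Matrix.conjTranspose_conjTranspose, Matrix.mul_assoc]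
  have h2 : ∀ g, (((U g)ᴴ * Y * U g) * σ * ((U g)ᴴ * Y * U g)ᴴ).trace =
      (Y * (U g * σ * (U g)ᴴ) * Yᴴ).trace := by
    intro g
    have : ((U g)ᴴ * Y * U g) * σ * ((U g)ᴴ * Y * U g)ᴴ =
        (U g)ᴴ * (Y * (U g * σ * (U g)ᴴ) * Yᴴ * U g) := by
      simp only [Matrix.conjTranspose_mul, Matrix.conjTranspose_conjTranspose, Matrix.mul_assoc]
    rw [this, Matrix.trace_mul_comm, Matrix.mul_assoc, hU', Matrix.mul_one]
  have h3 : ∀ g, (((U g)ᴴ * Y * U g)ᴴ * ρ * ((U g)ᴴ * Y * U g)).trace =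
      (Yᴴ * (U g * ρ * (U g)ᴴ) * Y).trace := by
    intro g
    have : ((U g)ᴴ * Y * U g)ᴴ * ρ * ((U g)ᴴ * Y * U g) =
        (U g)ᴴ * (Yᴴ * (U g * ρ * (U g)ᴴ) * Y * U g) := by
      simp only [Matrix.conjTranspose_mul, Matrix.conjTranspose_conjTranspose, Matrix.mul_assoc]
    rw [this, Matrix.trace_mul_comm, Matrix.mul_assoc, hU', Matrix.mul_one]
  simp only [resolventForm, h1, h2, h3, twirl, Matrix.mul_smul, Matrix.smul_mul,
    Matrix.mul_sum, Matrix.sum_mul, Matrix.trace_smul, Matrix.trace_sum, Complex.smul_re,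
    Complex.re_sum, smul_eq_mul, Finset.sum_sub_distrib]
  simp only [← Finset.mul_sum]
  ring

omit [DecidableEq n] in
theorem conj_twirl [Group G] (hmul : ∀ g h, U (g * h) = U g * U h) (g : G)
    (X : Matrix n n ℂ) : U g * twirl U X * (U g)ᴴ = twirl U X := by
  rw [twirl, Matrix.mul_smul, Matrix.smul_mul, Matrix.mul_sum, Matrix.sum_mul]
  congr 1
  refine Fintype.sum_equiv (Equiv.mulLeft g) _ _ fun h => ?_
  rw [Equiv.coe_mulLeft, hmul, Matrix.conjTranspose_mul]
  simp only [Matrix.mul_assoc]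

theorem relEnt_twirl_le [Nonempty G] (hU : ∀ g, (U g)ᴴ * U g = 1)
    (hU' : ∀ g, U g * (U g)ᴴ = 1) {ρ σ : Matrix n n ℂ} (hρ : ρ.PosSemidef)
    (hσ : σ.PosSemidef) : relEnt (twirl U ρ) (twirl U σ) ≤ relEnt ρ σ := by
  by_cases h : suppLE ρ σ
  swap
  · rw [relEnt, relEnt, if_neg h]
    exact le_top
  have h' : suppLE (twirl U ρ) (twirl U σ) := h.twirl hσ
  have hρ' : (twirl U ρ).PosSemidef := PosSemidef.twirl hρ
  have hσ' : (twirl U σ).PosSemidef := PosSemidef.twirl hσ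
  rw [relEnt, relEnt, if_pos h, if_pos h', EReal.coe_le_coe_iff,
    trace_mul_matLog_sub_re hρ.1 hσ.1, trace_mul_matLog_sub_re hρ'.1 hσ'.1]
  refine div_le_div_of_nonneg_right ?_ (Real.log_nonneg one_le_two)
  have overlap : ∀ {α β : Matrix n n ℂ} (hα : α.IsHermitian) (hβ : β.IsHermitian),
      suppLE α β → ∀ i j, hα.eigenvalues i ≠ 0 → hβ.eigenvalues j = 0 →
      ((hα.eigenvectorUnitary : Matrix n n ℂ)ᴴ * hβ.eigenvectorUnitary) i j = 0 := by
    intro α β hα hβ hs i j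
    rw [eq_eigenvectorUnitary_mul_diagonal hα, eq_eigenvectorUnitary_mul_diagonal hβ] at hs
    exact hs.overlap_eq_zero (conjTranspose_eigenvectorUnitary_mul_self hα)
      (conjTranspose_eigenvectorUnitary_mul_self hβ)
  refine entropySum_le_of_resolventMax_le hρ'.eigenvalues_nonneg hσ'.eigenvalues_nonneg
    (overlap hρ'.1 hσ'.1 h') hρ.eigenvalues_nonneg hσ.eigenvalues_nonneg
    (overlap hρ.1 hσ.1 h) ?_ fun s hs => ?_
  · rw [← trace_re_eq_sum_overlap, ← trace_re_eq_sum_overlap, trace_twirl_re hU]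
  · obtain ⟨Y, hY⟩ := exists_resolventForm_eq
      (conjTranspose_eigenvectorUnitary_mul_self hρ'.1)
      (conjTranspose_eigenvectorUnitary_mul_self hσ'.1)
      hρ'.eigenvalues_nonneg hσ'.eigenvalues_nonneg hs
    rw [← hY, ← eq_eigenvectorUnitary_mul_diagonal, ← eq_eigenvectorUnitary_mul_diagonal,
      resolventForm_twirl hU', inv_mul_le_iff₀ (by positivity), ← nsmul_eq_mul,
      ← Finset.card_univ]
    refine Finset.sum_le_card_nsmul _ _ _ fun g _ => ?_
    have hle := resolventForm_le (conjTranspose_eigenvectorUnitary_mul_self hρ.1)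
      (eigenvectorUnitary_mul_conjTranspose_self hρ.1)
      (conjTranspose_eigenvectorUnitary_mul_self hσ.1)
      (eigenvectorUnitary_mul_conjTranspose_self hσ.1)
      hρ.eigenvalues_nonneg hσ.eigenvalues_nonneg hs ((U g)ᴴ * Y * U g)
    rwa [← eq_eigenvectorUnitary_mul_diagonal, ← eq_eigenvectorUnitary_mul_diagonal] at hle

end Twirl

section Permutations

variable {d m : ℕ}

theorem permMat_mul (π τ : Equiv.Perm (Fin m)) :
    permMat d m π * permMat d m τ = permMat d m (π * τ) := by
  ext f g
  rw [Matrix.mul_apply, Finset.sum_eq_single (f ∘ π)]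
  · by_cases h : f ∘ ⇑π ∘ ⇑τ = g <;> simp [permMat, Function.comp_assoc, h]
  · intro j _ hj
    simp [permMat, hj.symm]
  · simp

theorem permMat_one : permMat d m 1 = 1 := by
  ext f g
  simp [permMat, Matrix.one_apply]

theorem conjTranspose_permMat (π : Equiv.Perm (Fin m)) :
    (permMat d m π)ᴴ = permMat d m π⁻¹ := by
  ext f g
  have : g ∘ π = f ↔ f ∘ ⇑π⁻¹ = g := by
    constructor <;> rintro rfl <;> ext <;> simp
  simp only [permMat, Matrix.conjTranspose_apply, Matrix.of_apply, this]
  split_ifs <;> simp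

theorem conjTranspose_permMat_mul_self (π : Equiv.Perm (Fin m)) :
    (permMat d m π)ᴴ * permMat d m π = 1 := by
  rw [conjTranspose_permMat, permMat_mul, inv_mul_cancel, permMat_one]

theorem permMat_mul_conjTranspose_self (π : Equiv.Perm (Fin m)) :
    permMat d m π * (permMat d m π)ᴴ = 1 := by
  rw [conjTranspose_permMat, permMat_mul, mul_inv_cancel, permMat_one]

theorem twirl_permMat_mem_invariantOps (X : Matrix (Fin m → Fin d) (Fin m → Fin d) ℂ) :
    twirl (permMat d m) X ∈ invariantOps d m := fun π =>
  conj_twirl (fun g h => (permMat_mul g h).symm) π X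

theorem twirl_permMat_mem {S : Set (Matrix (Fin m → Fin d) (Fin m → Fin d) ℂ)}
    (hconv : Convex ℝ S) (hperm : PermInvSet d m S)
    {X : Matrix (Fin m → Fin d) (Fin m → Fin d) ℂ} (hX : X ∈ S) :
    twirl (permMat d m) X ∈ S := by
  rw [twirl, Finset.smul_sum]
  refine hconv.sum_mem (fun _ _ => by positivity) (by simp) fun π _ => ?_
  rw [← hperm π]
  exact Set.mem_image_of_mem _ hX

theorem iInf_eq_iInf_inter_of_map_le {α : Type*} {A B C : Set α} (f : α → α → EReal)
    (t : α → α) (hA : ∀ a ∈ A, t a ∈ A ∩ C) (hB : ∀ b ∈ B, t b ∈ B ∩ C)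
    (hf : ∀ a ∈ A, ∀ b ∈ B, f (t a) (t b) ≤ f a b) :
    ⨅ a ∈ A, ⨅ b ∈ B, f a b = ⨅ a ∈ A ∩ C, ⨅ b ∈ B ∩ C, f a b := by
  refine le_antisymm
    (le_iInf₂ fun a ha => le_iInf₂ fun b hb => iInf₂_le_of_le a ha.1 (iInf₂_le b hb.1))
    (le_iInf₂ fun a ha => le_iInf₂ fun b hb =>
      iInf₂_le_of_le (t a) (hA a ha) (iInf₂_le_of_le (t b) (hB b hb) (hf a ha b hb)))

end Permutations

/-- for convex, compact, permutation-invariant sets the optimizers in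
`D(A‖B)` and `D_M(A‖B)` can be restricted to permutation-invariant operators. -/
theorem relEntSet_restrict_invariant (d m : ℕ) (hd : 1 ≤ d) (hm : 1 ≤ m)
    (A B : Set (Matrix (Fin m → Fin d) (Fin m → Fin d) ℂ))
    (hA : ∀ ρ ∈ A, ρ.PosSemidef ∧ ρ.trace = 1)
    (hAconv : Convex ℝ A) (hAcomp : IsCompact A) (hAperm : PermInvSet d m A)
    (hB : ∀ σ ∈ B, σ.PosSemidef)
    (hBconv : Convex ℝ B) (hBcomp : IsCompact B) (hBperm : PermInvSet d m B) :
    relEntSet A B = relEntSet (A ∩ invariantOps d m) (B ∩ invariantOps d m) ∧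
    measRelEntSet A B = measRelEntSet (A ∩ invariantOps d m) (B ∩ invariantOps d m) := by
  have hA' : ∀ ρ ∈ A, twirl (permMat d m) ρ ∈ A ∩ invariantOps d m := fun ρ hρ =>
    ⟨twirl_permMat_mem hAconv hAperm hρ, twirl_permMat_mem_invariantOps ρ⟩
  have hB' : ∀ σ ∈ B, twirl (permMat d m) σ ∈ B ∩ invariantOps d m := fun σ hσ =>
    ⟨twirl_permMat_mem hBconv hBperm hσ, twirl_permMat_mem_invariantOps σ⟩
  exact ⟨iInf_eq_iInf_inter_of_map_le relEnt _ hA' hB' fun ρ hρ σ hσ =>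
      relEnt_twirl_le conjTranspose_permMat_mul_self permMat_mul_conjTranspose_self
        (hA ρ hρ).1 (hB σ hσ),
    iInf_eq_iInf_inter_of_map_le measRelEnt _ hA' hB' fun ρ _ σ _ =>
      measRelEnt_twirl_le conjTranspose_permMat_mul_self ρ σ⟩

end QIT
end
end

section
/- Let X₁, X₂ be positive semidefinite complex matrices and Y₁, Y₂ Hermitian matrices (of matching sizes) with −X₁ ≤ Y₁ ≤ X₁ and −X₂ ≤ Y₂ ≤ X₂. Then −X₁ ⊗ X₂ ≤ Y₁ ⊗ Y₂ ≤ X₁ ⊗ X₂. -/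
open scoped Kronecker ComplexOrder Matrix

attribute [local instance] Classical.propDecidable

noncomputable section

namespace QIT

variable {n : Type*} [Fintype n] [DecidableEq n]

/-- `X₁ ⊗ X₂ + Y₁ ⊗ Y₂` is positive semidefinite when `±Y₁ ≤ X₁` and `±Y₂ ≤ X₂`, being the average
of `(X₁ + Y₁) ⊗ (X₂ + Y₂)` and `(X₁ - Y₁) ⊗ (X₂ - Y₂)`. -/
theorem posSemidef_kronecker_add_kronecker {n₁ n₂ : Type*} [Fintype n₁] [Fintype n₂]
    {X₁ Y₁ : Matrix n₁ n₁ ℂ} {X₂ Y₂ : Matrix n₂ n₂ ℂ}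
    (hadd₁ : (X₁ + Y₁).PosSemidef) (hsub₁ : (X₁ - Y₁).PosSemidef)
    (hadd₂ : (X₂ + Y₂).PosSemidef) (hsub₂ : (X₂ - Y₂).PosSemidef) :
    (X₁ ⊗ₖ X₂ + Y₁ ⊗ₖ Y₂).PosSemidef := by
  have havg : X₁ ⊗ₖ X₂ + Y₁ ⊗ₖ Y₂ =
      (1 / 2 : ℂ) • ((X₁ + Y₁) ⊗ₖ (X₂ + Y₂) + (X₁ - Y₁) ⊗ₖ (X₂ - Y₂)) := by
    ext i j
    simp only [Matrix.add_apply, Matrix.sub_apply, Matrix.smul_apply, Matrix.kroneckerMap_apply,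
      smul_eq_mul]
    ring
  rw [havg]
  exact ((hadd₁.kronecker hadd₂).add (hsub₁.kronecker hsub₂)).smul (by positivity)

/-- if `−X₁ ≤ Y₁ ≤ X₁` and `−X₂ ≤ Y₂ ≤ X₂` in the Loewner order, then
`−X₁ ⊗ X₂ ≤ Y₁ ⊗ Y₂ ≤ X₁ ⊗ X₂`. -/
theorem kronecker_loewner_sandwich {n₁ n₂ : Type*}
    [Fintype n₁] [DecidableEq n₁] [Fintype n₂] [DecidableEq n₂]
    (X₁ Y₁ : Matrix n₁ n₁ ℂ) (X₂ Y₂ : Matrix n₂ n₂ ℂ)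
    (hX₁ : X₁.PosSemidef) (hX₂ : X₂.PosSemidef)
    (hY₁ : Y₁.IsHermitian) (hY₂ : Y₂.IsHermitian)
    (h₁l : (Y₁ - -X₁).PosSemidef) (h₁u : (X₁ - Y₁).PosSemidef)
    (h₂l : (Y₂ - -X₂).PosSemidef) (h₂u : (X₂ - Y₂).PosSemidef) :
    (Y₁ ⊗ₖ Y₂ - -(X₁ ⊗ₖ X₂)).PosSemidef ∧ (X₁ ⊗ₖ X₂ - Y₁ ⊗ₖ Y₂).PosSemidef := by
  rw [sub_neg_eq_add, add_comm] at h₁l h₂l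
  constructor
  · rw [sub_neg_eq_add, add_comm]
    exact posSemidef_kronecker_add_kronecker h₁l h₁u h₂l h₂u
  · have hneg : X₁ ⊗ₖ X₂ - Y₁ ⊗ₖ Y₂ = X₁ ⊗ₖ X₂ + (-Y₁) ⊗ₖ Y₂ := by
      ext i j
      simp [sub_eq_add_neg]
    rw [hneg]
    exact posSemidef_kronecker_add_kronecker (by rwa [← sub_eq_add_neg])
      (by rwa [sub_neg_eq_add]) h₂l h₂u

end QIT
end
end

section
/- Let k ≥ 2. If ω ∈ PPT_k(A:B) and ω' ∈ PPT_k(A':B'), then ω ⊗ ω' ∈ PPT_k(AA':BB'), where the Kronecker product is reindexed so that the bipartition is (A×A') versus (B×B') and the partial transpose is taken over B×B'. -/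
open scoped Kronecker ComplexOrder Matrix

attribute [local instance] Classical.propDecidable

noncomputable section

namespace QIT

variable {n : Type*} [Fintype n] [DecidableEq n]

open Polynomial in
/-- If a Hermitian matrix has a characteristic polynomial that splits with real roots `d`, then
sums over its eigenvalues are sums over `d`. -/
lemma sum_eigenvalues_of_charpoly_eq {m : Type*} [Fintype m] {M : Matrix n n ℂ}
    (hM : M.IsHermitian) (d : m → ℝ) (h : M.charpoly = ∏ i, (X - C (d i : ℂ))) (f : ℝ → ℝ) :
    ∑ i, f (hM.eigenvalues i) = ∑ i, f (d i) := by
  have h₁ := hM.roots_charpoly_eq_eigenvalues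
  rw [h, Polynomial.roots_prod _ _ (Finset.prod_ne_zero_iff.mpr fun i _ => X_sub_C_ne_zero _)] at h₁
  have h₂ := congrArg (fun s : Multiset ℂ => (s.map fun z => f z.re).sum) h₁
  simpa [Multiset.bind_singleton, Multiset.map_map] using h₂.symm

open Polynomial in
/-- The characteristic polynomial of a Kronecker product of Hermitian matrices has the products of
the eigenvalues of the factors as its roots. -/
lemma charpoly_kronecker_of_isHermitian {m : Type*} [Fintype m] [DecidableEq m]
    {M : Matrix n n ℂ} {N : Matrix m m ℂ} (hM : M.IsHermitian) (hN : N.IsHermitian) :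
    (M ⊗ₖ N).charpoly =
      ∏ p : n × m, (X - C ((hM.eigenvalues p.1 * hN.eigenvalues p.2 : ℝ) : ℂ)) := by
  conv_lhs => rw [hM.spectral_theorem, hN.spectral_theorem, Unitary.conjStarAlgAut_apply,
    Unitary.conjStarAlgAut_apply, Matrix.mul_kronecker_mul, Matrix.charpoly_mul_comm,
    Matrix.mul_kronecker_mul, ← mul_assoc, ← Matrix.mul_kronecker_mul,
    Matrix.diagonal_kronecker_diagonal]
  simp [Matrix.charpoly_diagonal]

lemma conjTranspose_mul_self_kron2 {α β γ δ : Type*} [Fintype α] [Fintype β] [Fintype γ]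
    [Fintype δ] (X : Matrix (α × β) (α × β) ℂ) (Y : Matrix (γ × δ) (γ × δ) ℂ) :
    (kron2 X Y)ᴴ * kron2 X Y = kron2 (Xᴴ * X) (Yᴴ * Y) := by
  simp only [kron2, Matrix.reindex_apply, Matrix.conjTranspose_submatrix,
    Matrix.submatrix_mul_equiv, Matrix.conjTranspose_kronecker, Matrix.mul_kronecker_mul]

/-- The trace norm is multiplicative under tensor products. -/
lemma traceNorm_kron2 {α β γ δ : Type*} [Fintype α] [Fintype β] [Fintype γ] [Fintype δ]
    [DecidableEq (α × β)] [DecidableEq (γ × δ)] [DecidableEq ((α × γ) × β × δ)]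
    (X : Matrix (α × β) (α × β) ℂ) (Y : Matrix (γ × δ) (γ × δ) ℂ) :
    traceNorm (kron2 X Y) = traceNorm X * traceNorm Y := by
  have hX := Matrix.posSemidef_conjTranspose_mul_self X
  have hY := Matrix.posSemidef_conjTranspose_mul_self Y
  have h := charpoly_kronecker_of_isHermitian hX.1 hY.1
  rw [← Matrix.charpoly_reindex (Equiv.prodProdProdComm α β γ δ)] at h
  change (kron2 _ _).charpoly = _ at h
  rw [← conjTranspose_mul_self_kron2] at h
  unfold traceNorm
  rw [sum_eigenvalues_of_charpoly_eq _ _ h Real.sqrt, Finset.sum_mul_sum, Fintype.sum_prod_type]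
  simp only [Real.sqrt_mul (hX.eigenvalues_nonneg _)]

lemma traceNorm_nonneg (A : Matrix n n ℂ) : 0 ≤ traceNorm A :=
  Finset.sum_nonneg fun _ _ => Real.sqrt_nonneg _

section Kron2

variable {α β γ δ : Type*}

lemma ptB_kron2 (X : Matrix (α × β) (α × β) ℂ) (Y : Matrix (γ × δ) (γ × δ) ℂ) :
    ptB (kron2 X Y) = kron2 (ptB X) (ptB Y) :=
  rfl

lemma isHermitian_kron2 {X : Matrix (α × β) (α × β) ℂ} {Y : Matrix (γ × δ) (γ × δ) ℂ}
    (hX : X.IsHermitian) (hY : Y.IsHermitian) : (kron2 X Y).IsHermitian := by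
  have h : (X ⊗ₖ Y).IsHermitian := by
    rw [Matrix.IsHermitian, Matrix.conjTranspose_kronecker, hX.eq, hY.eq]
  exact h.submatrix _

variable [Fintype α] [Fintype β] [Fintype γ] [Fintype δ]

lemma posSemidef_kron2 {X : Matrix (α × β) (α × β) ℂ} {Y : Matrix (γ × δ) (γ × δ) ℂ}
    (hX : X.PosSemidef) (hY : Y.PosSemidef) : (kron2 X Y).PosSemidef :=
  (hX.kronecker hY).submatrix _

/-- If `-A ≤ P ≤ A` and `-B ≤ Q ≤ B`, then `P ⊗ Q ≤ A ⊗ B`. -/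
lemma posSemidef_kron2_sub_kron2 {A P : Matrix (α × β) (α × β) ℂ}
    {B Q : Matrix (γ × δ) (γ × δ) ℂ}
    (hA : (A - P).PosSemidef) (hA' : (A + P).PosSemidef)
    (hB : (B - Q).PosSemidef) (hB' : (B + Q).PosSemidef) :
    (kron2 A B - kron2 P Q).PosSemidef := by
  have h : kron2 A B - kron2 P Q =
      (1 / 2 : ℝ) • (kron2 (A + P) (B - Q) + kron2 (A - P) (B + Q)) := by
    ext i j
    simp [kron2, Matrix.kroneckerMap_apply]
    ring
  rw [h]
  exact ((posSemidef_kron2 hA' hB).add (posSemidef_kron2 hA hB')).smul (by norm_num)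

/-- If `-A ≤ P ≤ A` and `-B ≤ Q ≤ B`, then `-(A ⊗ B) ≤ P ⊗ Q`. -/
lemma posSemidef_kron2_add_kron2 {A P : Matrix (α × β) (α × β) ℂ}
    {B Q : Matrix (γ × δ) (γ × δ) ℂ}
    (hA : (A - P).PosSemidef) (hA' : (A + P).PosSemidef)
    (hB : (B - Q).PosSemidef) (hB' : (B + Q).PosSemidef) :
    (kron2 A B + kron2 P Q).PosSemidef := by
  have h : kron2 A B + kron2 P Q = kron2 A B - kron2 (-P) Q := by
    ext i j
    simp [kron2, Matrix.kroneckerMap_apply]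
  rw [h]
  exact posSemidef_kron2_sub_kron2 (by rwa [sub_neg_eq_add]) (by rwa [← sub_eq_add_neg]) hB hB'

end Kron2

/-- the `PPT_k` sets are closed under (reindexed) tensor products. -/
theorem pptk_tensor_closed {dA dB dA' dB' : ℕ} (k : ℕ) (hk : 2 ≤ k)
    (ω : Matrix (Fin dA × Fin dB) (Fin dA × Fin dB) ℂ)
    (ω' : Matrix (Fin dA' × Fin dB') (Fin dA' × Fin dB') ℂ)
    (hω : memPPTk k ω) (hω' : memPPTk k ω') :
    memPPTk k (kron2 ω ω') := by
  obtain ⟨hpos, w, rfl, hherm, hle, hnorm⟩ := hω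
  obtain ⟨hpos', w', rfl, hherm', hle', hnorm'⟩ := hω'
  refine ⟨posSemidef_kron2 hpos hpos', fun i => kron2 (w i) (w' i), rfl,
    fun i hi => isHermitian_kron2 (hherm i hi) (hherm' i hi), fun i hi => ?_, ?_⟩
  · obtain ⟨h₁, h₂⟩ := hle i hi
    obtain ⟨h₁', h₂'⟩ := hle' i hi
    rw [ptB_kron2]
    exact ⟨posSemidef_kron2_sub_kron2 h₁ h₂ h₁' h₂', posSemidef_kron2_add_kron2 h₁ h₂ h₁' h₂'⟩
  · rw [ptB_kron2, traceNorm_kron2]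
    exact mul_le_one₀ hnorm (traceNorm_nonneg _) hnorm'

end QIT
end
end
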